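/- arXiv:math/0612770 — 3 statements merged into one kernel-verified Lean document; each statement's English description precedes it below -/
import Mathlib

section
/- One has c(1) = (ζ(2)·ζ(3)²)^{−1/3} and e(1) = 3·(ζ(3)/ζ(2))^{1/3}, and for every λ > 0, e(λ) ≤ e(1); that is, the function e attains its maximum over (0,∞) at λ = 1. -/
open Real MeasureTheory

/-- `A(λ) = ζ(3) − Li₃(1−λ)` as an integral over the positive quadrant. -/
noncomputable def Aint (l : ℝ) : ℝ :=
  ∫ t : ℝ × ℝ in Set.Ioi (0:ℝ) ×ˢ Set.Ioi (0:ℝ),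
    l * t.1 * Real.exp (-(t.1 + t.2)) /
      ((1 - Real.exp (-(t.1 + t.2))) * (1 + (l - 1) * Real.exp (-(t.1 + t.2))))

/-- `B(λ) = λ·Li₂(1−λ)/(1−λ)` as an integral over the positive quadrant. -/
noncomputable def Bint (l : ℝ) : ℝ :=
  ∫ t : ℝ × ℝ in Set.Ioi (0:ℝ) ×ˢ Set.Ioi (0:ℝ),
    l * Real.exp (-(t.1 + t.2)) / (1 + (l - 1) * Real.exp (-(t.1 + t.2)))

noncomputable def zeta2 : ℝ := π ^ 2 / 6

noncomputable def zeta3 : ℝ := ∑' k : ℕ, 1 / ((k : ℝ) + 1) ^ 3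

noncomputable def cfun (l : ℝ) : ℝ := Bint l / (zeta2 ^ ((1:ℝ)/3) * Aint l ^ ((2:ℝ)/3))

noncomputable def efun (l : ℝ) : ℝ :=
  3 * (Aint l / zeta2) ^ ((1:ℝ)/3) - cfun l * Real.log l

/-- The Bose-type weight `σ² / (2 (1 - e^{-σ}))`; it vanishes at `0`. -/
noncomputable def boseWeight (σ : ℝ) : ℝ := σ ^ 2 / 2 / (1 - exp (-σ))

/-- The primitive of `boseWeight` vanishing at `0`. -/
noncomputable def bosePrimitive (s : ℝ) : ℝ := ∫ σ in (0:ℝ)..s, boseWeight σ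

lemma one_sub_exp_neg_pos {s : ℝ} (hs : 0 < s) : 0 < 1 - exp (-s) := by
  have : exp (-s) < 1 := by rw [← exp_zero]; exact exp_lt_exp.mpr (by linarith)
  linarith

lemma abs_boseWeight_le (σ : ℝ) : |boseWeight σ| ≤ (σ ^ 2 + |σ|) / 2 := by
  unfold boseWeight
  rcases lt_trichotomy σ 0 with h | h | h
  · have h1 : -σ + 1 ≤ exp (-σ) := add_one_le_exp (-σ)
    have h2 : 1 - exp (-σ) < 0 := by linarith
    rw [abs_div, abs_of_neg h2, abs_of_neg h, abs_of_nonneg (by positivity),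
      div_le_iff₀ (by linarith)]
    nlinarith [sq_nonneg σ, mul_nonneg (sq_nonneg σ) (by linarith : 0 ≤ exp (-σ) - 1 + σ)]
  · simp [h]
  · have h2 := one_sub_exp_neg_pos h
    have h1 : σ + 1 ≤ exp σ := add_one_le_exp σ
    have h3 : exp σ * exp (-σ) = 1 := by rw [← exp_add]; simp
    have h4 : σ ≤ (σ + 1) * (1 - exp (-σ)) := by
      nlinarith [exp_pos (-σ)]
    rw [abs_div, abs_of_pos h2, abs_of_pos h, abs_of_nonneg (by positivity),
      div_le_iff₀ h2]
    nlinarith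

lemma continuous_boseWeight : Continuous boseWeight := by
  rw [continuous_iff_continuousAt]
  intro σ
  by_cases h : σ = 0
  · subst h
    have h0 : boseWeight 0 = 0 := by simp [boseWeight]
    rw [ContinuousAt, h0]
    refine squeeze_zero_norm (a := fun σ : ℝ => (σ ^ 2 + |σ|) / 2) abs_boseWeight_le ?_
    have : Continuous (fun σ : ℝ => (σ ^ 2 + |σ|) / 2) := by fun_prop
    simpa using this.tendsto 0
  · have : 1 - exp (-σ) ≠ 0 := by
      intro h'
      have : exp (-σ) = 1 := by linarith
      rw [exp_eq_one_iff] at this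
      exact h (by linarith)
    unfold boseWeight
    fun_prop (disch := assumption)

lemma boseWeight_nonneg {σ : ℝ} (h : 0 ≤ σ) : 0 ≤ boseWeight σ := by
  have : exp (-σ) ≤ 1 := exp_le_one_iff.mpr (by linarith)
  exact div_nonneg (by positivity) (by linarith)

lemma hasDerivAt_bosePrimitive (s : ℝ) : HasDerivAt bosePrimitive (boseWeight s) s :=
  intervalIntegral.integral_hasDerivAt_right (continuous_boseWeight.intervalIntegrable _ _)
    (continuous_boseWeight.stronglyMeasurableAtFilter _ _) continuous_boseWeight.continuousAt

lemma continuous_bosePrimitive : Continuous bosePrimitive :=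
  continuous_iff_continuousAt.mpr fun s => (hasDerivAt_bosePrimitive s).continuousAt

lemma bosePrimitive_pos {s : ℝ} (hs : 0 < s) : 0 < bosePrimitive s := by
  refine intervalIntegral.intervalIntegral_pos_of_pos_on
    (continuous_boseWeight.intervalIntegrable _ _) (fun x hx => ?_) hs
  have := one_sub_exp_neg_pos hx.1
  have := hx.1
  unfold boseWeight
  positivity

lemma boseWeight_mul_le_bosePrimitive {s : ℝ} (hs : 0 < s) :
    s * boseWeight s ≤ 3 * bosePrimitive s := by
  have hd := one_sub_exp_neg_pos hs
  have h : ∫ σ in (0:ℝ)..s, σ ^ 2 / 2 / (1 - exp (-s)) ≤ bosePrimitive s := by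
    refine intervalIntegral.integral_mono_on_of_le_Ioo hs.le
      (Continuous.intervalIntegrable (by fun_prop) _ _)
      (continuous_boseWeight.intervalIntegrable _ _) (fun x hx => ?_)
    have hx0 := one_sub_exp_neg_pos hx.1
    have : exp (-s) ≤ exp (-x) := exp_le_exp.mpr (by linarith [hx.2])
    unfold boseWeight
    gcongr
  have h2 : ∫ σ in (0:ℝ)..s, σ ^ 2 / 2 / (1 - exp (-s)) = s ^ 3 / 6 / (1 - exp (-s)) := by
    simp only [intervalIntegral.integral_div, integral_pow]
    norm_num
    ring
  rw [h2] at h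
  unfold boseWeight
  calc _ = 3 * (s ^ 3 / 6 / (1 - exp (-s))) := by ring
    _ ≤ _ := by linarith

lemma monotoneOn_cube_div_bosePrimitive :
    MonotoneOn (fun s => s ^ 3 / bosePrimitive s) (Set.Ioi 0) := by
  have hder : ∀ s ∈ Set.Ioi (0:ℝ), HasDerivAt (fun s => s ^ 3 / bosePrimitive s)
      ((3 * s ^ 2 * bosePrimitive s - s ^ 3 * boseWeight s) / bosePrimitive s ^ 2) s := by
    intro s hs
    have := (hasDerivAt_pow 3 s).div (hasDerivAt_bosePrimitive s) (bosePrimitive_pos hs).ne'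
    convert! this using 1
  refine monotoneOn_of_deriv_nonneg (convex_Ioi 0)
    (fun s hs => (hder s hs).continuousAt.continuousWithinAt) ?_ ?_
  · rw [interior_Ioi]
    exact fun s hs => (hder s hs).differentiableAt.differentiableWithinAt
  · rw [interior_Ioi]
    intro s hs
    rw [(hder s hs).deriv]
    refine div_nonneg ?_ (sq_nonneg _)
    nlinarith [mul_nonneg (sq_nonneg s)
      (sub_nonneg.mpr (boseWeight_mul_le_bosePrimitive hs))]

lemma hasDerivAt_bosePrimitive_log (r : ℝ) (hr : 0 < r) (u : ℝ) :
    HasDerivAt (fun u => bosePrimitive (log (1 + exp u * r)))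
      (log (1 + exp u * r) ^ 2 / 2) u := by
  have hp : 0 < exp u * r := by positivity
  have h1 : HasDerivAt (fun u => log (1 + exp u * r)) (exp u * r / (1 + exp u * r)) u :=
    (((hasDerivAt_exp u).mul_const r).const_add 1).log (by positivity)
  have h2 := (hasDerivAt_bosePrimitive (log (1 + exp u * r))).comp u h1
  convert! h2 using 1
  unfold boseWeight
  rw [exp_neg, exp_log (by positivity)]
  field_simp
  ring

lemma log_one_add_pos {p : ℝ} (hp : 0 < p) : 0 < log (1 + p) := log_pos (by linarith)

lemma convexOn_rpow_bosePrimitive_log (r : ℝ) (hr : 0 < r) :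
    ConvexOn ℝ Set.univ (fun u => bosePrimitive (log (1 + exp u * r)) ^ ((1:ℝ)/3)) := by
  have hS : ∀ u, 0 < log (1 + exp u * r) := fun u => log_one_add_pos (by positivity)
  have hder : ∀ u, HasDerivAt (fun u => bosePrimitive (log (1 + exp u * r)) ^ ((1:ℝ)/3))
      (1 / 6 * (log (1 + exp u * r) ^ 3 / bosePrimitive (log (1 + exp u * r))) ^ ((2:ℝ)/3)) u := by
    intro u
    have hP := bosePrimitive_pos (hS u)
    have h := (hasDerivAt_bosePrimitive_log r hr u).rpow_const (p := (1:ℝ)/3) (Or.inl hP.ne')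
    convert h using 1
    rw [div_rpow (by have := hS u; positivity) hP.le, ← rpow_natCast, ← rpow_mul (hS u).le,
      show (1:ℝ)/3 - 1 = -(2/3) by norm_num, rpow_neg hP.le]
    norm_num
    field_simp
    ring
  refine MonotoneOn.convexOn_of_deriv convex_univ
    (fun u _ => (hder u).continuousAt.continuousWithinAt)
    (fun u _ => (hder u).differentiableAt.differentiableWithinAt) ?_
  intro u _ v _ huv
  rw [(hder u).deriv, (hder v).deriv]
  have h := monotoneOn_cube_div_bosePrimitive (hS u) (hS v)
    (log_le_log (by positivity) (by gcongr))
  have h0 : 0 ≤ log (1 + exp u * r) ^ 3 / bosePrimitive (log (1 + exp u * r)) :=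
    div_nonneg (pow_nonneg (hS u).le 3) (bosePrimitive_pos (hS u)).le
  have := rpow_le_rpow h0 h (by norm_num : (0:ℝ) ≤ 2/3)
  linarith

/-- The tangent-line inequality for the convex function `u ↦ Φ(log (1 + e^u r))^{1/3}`, `Φ` being
`bosePrimitive`, combined with Young's inequality. -/
lemma bosePrimitive_tangent_le {r l κ : ℝ} (hr : 0 < r) (hl : 0 < l) (hκ : 0 < κ) :
    3 * bosePrimitive (log (1 + l * r)) - log l * (log (1 + l * r) ^ 2 / 2) ≤
      κ ^ 2 * bosePrimitive (log (1 + r)) + 2 / κ * bosePrimitive (log (1 + l * r)) := by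
  have hc := convexOn_rpow_bosePrimitive_log r hr
  obtain ⟨u, rfl⟩ : ∃ u, l = exp u := ⟨log l, (exp_log hl).symm⟩
  rw [log_exp]
  have hP := bosePrimitive_pos (log_one_add_pos (mul_pos (exp_pos u) hr))
  have hP0 := bosePrimitive_pos (log_one_add_pos hr)
  have hd := (hasDerivAt_bosePrimitive_log r hr u).rpow_const (p := (1:ℝ)/3) (Or.inl hP.ne')
  set h := bosePrimitive (log (1 + exp u * r)) ^ ((1:ℝ)/3) with hh
  set h0 := bosePrimitive (log (1 + r)) ^ ((1:ℝ)/3) with hh0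
  have hpos : 0 < h := rpow_pos_of_pos hP _
  have h0pos : 0 < h0 := rpow_pos_of_pos hP0 _
  have e : bosePrimitive (log (1 + exp u * r)) = h ^ 3 := by
    rw [hh, ← rpow_natCast, ← rpow_mul hP.le]; norm_num
  have e0 : bosePrimitive (log (1 + r)) = h0 ^ 3 := by
    rw [hh0, ← rpow_natCast, ← rpow_mul hP0.le]; norm_num
  have e2 : bosePrimitive (log (1 + exp u * r)) ^ ((1:ℝ)/3 - 1) = (h ^ 2)⁻¹ := by
    rw [hh, ← rpow_natCast, ← rpow_mul hP.le, ← rpow_neg hP.le]; norm_num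
  rw [e2] at hd
  set b := log (1 + exp u * r) ^ 2 / 2 with hb
  have htan : h - u * (b * (1/3) * (h ^ 2)⁻¹) ≤ h0 := by
    rcases lt_trichotomy u 0 with hu | hu | hu
    · have := hc.le_slope_of_hasDerivAt (Set.mem_univ u) (Set.mem_univ 0) hu hd
      rw [slope_def_field, le_div_iff₀ (by linarith)] at this
      simp only [exp_zero, one_mul, ← hh, ← hh0] at this
      linarith
    · simp [hh, hh0, hu]
    · have := hc.slope_le_of_hasDerivAt (Set.mem_univ 0) (Set.mem_univ u) hu hd
      rw [slope_def_field, div_le_iff₀ (by linarith)] at this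
      simp only [exp_zero, one_mul, ← hh, ← hh0] at this
      linarith
  have hyoung : 3 * h0 * h ^ 2 ≤ κ ^ 2 * h0 ^ 3 + 2 / κ * h ^ 3 := by
    have : 0 ≤ (κ * h0 - h) ^ 2 * (κ * h0 + 2 * h) / κ := by positivity
    have e3 : (κ * h0 - h) ^ 2 * (κ * h0 + 2 * h) / κ =
        κ ^ 2 * h0 ^ 3 + 2 / κ * h ^ 3 - 3 * h0 * h ^ 2 := by
      field_simp
      ring
    linarith
  rw [e, e0]
  have := mul_le_mul_of_nonneg_right htan (by positivity : 0 ≤ 3 * h ^ 2)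
  have e4 : (h - u * (b * (1/3) * (h ^ 2)⁻¹)) * (3 * h ^ 2) = 3 * h ^ 3 - u * b := by
    field_simp
  linarith

/-- The Fermi-type factor `λ e^{-s} / (1 + (λ - 1) e^{-s})`. -/
noncomputable def fermiFactor (l s : ℝ) : ℝ := l * exp (-s) / (1 + (l - 1) * exp (-s))

lemma fermiFactor_denom_pos {l s : ℝ} (hl : 0 < l) (hs : 0 < s) :
    0 < 1 + (l - 1) * exp (-s) := by
  nlinarith [one_sub_exp_neg_pos hs, mul_pos hl (exp_pos (-s))]

lemma fermiFactor_pos {l s : ℝ} (hl : 0 < l) (hs : 0 < s) : 0 < fermiFactor l s :=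
  div_pos (mul_pos hl (exp_pos _)) (fermiFactor_denom_pos hl hs)

lemma fermiFactor_one (s : ℝ) : fermiFactor 1 s = exp (-s) := by simp [fermiFactor]

lemma fermiFactor_le {l s : ℝ} (hl : 0 < l) (hs : 0 < s) :
    fermiFactor l s ≤ max 1 l * exp (-s) := by
  have h := one_sub_exp_neg_pos hs
  have h2 := exp_pos (-s)
  rw [fermiFactor, div_le_iff₀ (fermiFactor_denom_pos hl hs)]
  have : l ≤ max 1 l * (1 + (l - 1) * exp (-s)) := by
    rcases le_total 1 l with h1 | h1
    · rw [max_eq_right h1]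
      nlinarith [mul_nonneg (sub_nonneg.mpr h1) h2.le]
    · rw [max_eq_left h1]
      nlinarith
  nlinarith

@[fun_prop]
lemma measurable_fermiFactor (l : ℝ) : Measurable (fermiFactor l) := by
  unfold fermiFactor
  fun_prop

lemma lintegral_quadrant {f k : ℝ → ℝ} (hf : Continuous f) (hf0 : ∀ t, 0 < t → 0 ≤ f t)
    (hk : Measurable k) (hk0 : ∀ t, 0 < t → 0 ≤ k t) :
    ∫⁻ t : ℝ × ℝ in Set.Ioi (0:ℝ) ×ˢ Set.Ioi (0:ℝ), ENNReal.ofReal (f t.1 * k (t.1 + t.2)) =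
      ∫⁻ s in Set.Ioi (0:ℝ), ENNReal.ofReal ((∫ t in (0:ℝ)..s, f t) * k s) := by
  have hF : Continuous fun s : ℝ => ∫ t in (0:ℝ)..s, f t :=
    intervalIntegral.continuous_primitive (fun a b => hf.intervalIntegrable a b) 0
  have hk' : Measurable fun s => ENNReal.ofReal (k s) := hk.ennreal_ofReal
  have hlayer := lintegral_comp_eq_lintegral_meas_le_mul
    ((volume.restrict (Set.Ioi (0:ℝ))).withDensity fun s => ENNReal.ofReal (k s))
    (f := fun s => s) (g := f)
    ((withDensity_absolutelyContinuous _ _).ae_le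
      ((ae_restrict_mem measurableSet_Ioi).mono fun s hs => le_of_lt hs))
    aemeasurable_id (fun t _ => hf.intervalIntegrable _ _)
    ((ae_restrict_mem measurableSet_Ioi).mono fun s hs => hf0 s hs)
  rw [lintegral_withDensity_eq_lintegral_mul _ hk' hF.measurable.ennreal_ofReal] at hlayer
  rw [Measure.volume_eq_prod, ← Measure.prod_restrict, lintegral_prod _ (by fun_prop)]
  have hR : ∫⁻ s in Set.Ioi (0:ℝ), ENNReal.ofReal ((∫ t in (0:ℝ)..s, f t) * k s) =
      ∫⁻ s in Set.Ioi (0:ℝ), ((fun s => ENNReal.ofReal (k s)) *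
        fun s => ENNReal.ofReal (∫ t in (0:ℝ)..s, f t)) s := by
    refine setLIntegral_congr_fun measurableSet_Ioi fun s hs => ?_
    simp only [Pi.mul_apply]
    rw [mul_comm, ENNReal.ofReal_mul (hk0 s hs)]
  rw [hR, hlayer]
  refine setLIntegral_congr_fun measurableSet_Ioi fun t ht => ?_
  have ht' : 0 < t := ht
  simp only [ENNReal.ofReal_mul (hf0 t ht)]
  rw [lintegral_const_mul _ (by fun_prop), mul_comm,
    show {a : ℝ | t ≤ a} = Set.Ici t from rfl, withDensity_apply _ measurableSet_Ici, Measure.restrict_restrict measurableSet_Ici]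
  congr 1
  have h1 : Set.Ici t ∩ Set.Ioi 0 = Set.Ici t :=
    Set.inter_eq_left.mpr fun x hx => lt_of_lt_of_le ht' hx
  have h2 := (measurePreserving_add_left volume t).setLIntegral_comp_preimage
    (measurableSet_Ioi (a := t)) hk'
  have h3 : (fun x => t + x) ⁻¹' Set.Ioi t = Set.Ioi 0 := by ext; simp
  rw [h3] at h2
  rw [h2, h1, setLIntegral_congr Ioi_ae_eq_Ici]

lemma lintegral_mul_fermiFactor {l : ℝ} (hl : 0 < l) {f : ℝ → ℝ} (hf : Continuous f)
    (hf0 : ∀ t, 0 < t → 0 ≤ f t) :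
    ∫⁻ s in Set.Ioi (0:ℝ), ENNReal.ofReal (f s * fermiFactor l s) =
      ∫⁻ y in Set.Ioo (0:ℝ) 1,
        ENNReal.ofReal (∫ t in (0:ℝ)..log (1 + l * ((1 - y) / y)), f t) := by
  rw [lintegral_comp_eq_lintegral_meas_le_mul (volume.restrict (Set.Ioo (0:ℝ) 1))
    (f := fun y => log (1 + l * ((1 - y) / y))) (g := f)
    ((ae_restrict_mem measurableSet_Ioo).mono fun y hy => ?_)
    (by fun_prop) (fun t _ => hf.intervalIntegrable _ _)
    ((ae_restrict_mem measurableSet_Ioi).mono fun s hs => hf0 s hs)]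
  · refine setLIntegral_congr_fun measurableSet_Ioi fun s hs => ?_
    have hd := fermiFactor_denom_pos hl hs
    have hset : {y | s ≤ log (1 + l * ((1 - y) / y))} ∩ Set.Ioo 0 1 =
        Set.Ioc 0 (fermiFactor l s) := by
      ext y
      have hE := one_sub_exp_neg_pos hs
      have key : ∀ y, 0 < y → y < 1 → (s ≤ log (1 + l * ((1 - y) / y)) ↔ y ≤ fermiFactor l s) := by
        intro y h0 h1
        have h2 : 0 < 1 - y := by linarith
        rw [le_log_iff_exp_le (by positivity), fermiFactor, le_div_iff₀ hd,
          show 1 + l * ((1 - y) / y) = (y + l * (1 - y)) / y by field_simp, le_div_iff₀ h0,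
          show exp s = (exp (-s))⁻¹ by rw [exp_neg, inv_inv], inv_mul_le_iff₀ (exp_pos _)]
        constructor <;> intro h <;> nlinarith
      simp only [Set.mem_inter_iff, Set.mem_ofPred_eq, Set.mem_Ioo, Set.mem_Ioc]
      constructor
      · rintro ⟨h, h0, h1⟩
        exact ⟨h0, (key y h0 h1).mp h⟩
      · rintro ⟨h0, h⟩
        have h1 : y < 1 := by
          refine h.trans_lt ?_
          rw [fermiFactor, div_lt_one hd]
          linarith
        exact ⟨(key y h0 h1).mpr h, h0, h1⟩
    rw [Measure.restrict_apply' measurableSet_Ioo, hset, Real.volume_Ioc, sub_zero, mul_comm (f s),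
      ENNReal.ofReal_mul (fermiFactor_pos hl hs).le]
  · have h1 : 0 < 1 - y := by linarith [hy.2]
    have h0 := hy.1
    exact (log_one_add_pos (by positivity)).le

lemma Bint_integrand_eq (l : ℝ) (t : ℝ × ℝ) :
    l * exp (-(t.1 + t.2)) / (1 + (l - 1) * exp (-(t.1 + t.2))) =
      1 * fermiFactor l (t.1 + t.2) := by
  rw [one_mul, fermiFactor]

lemma Aint_integrand_eq (l : ℝ) (t : ℝ × ℝ) :
    l * t.1 * exp (-(t.1 + t.2)) /
      ((1 - exp (-(t.1 + t.2))) * (1 + (l - 1) * exp (-(t.1 + t.2)))) =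
      t.1 * (fermiFactor l (t.1 + t.2) / (1 - exp (-(t.1 + t.2)))) := by
  simp only [fermiFactor, div_eq_mul_inv, mul_inv]
  ring

lemma Bint_eq_toReal {l : ℝ} (hl : 0 < l) :
    Bint l = (∫⁻ s in Set.Ioi (0:ℝ), ENNReal.ofReal (s * fermiFactor l s)).toReal := by
  unfold Bint
  simp only [Bint_integrand_eq]
  rw [integral_eq_lintegral_of_nonneg_ae, lintegral_quadrant (f := fun _ => 1)
    continuous_const (fun _ _ => zero_le_one) (measurable_fermiFactor l)
    (fun t ht => (fermiFactor_pos hl ht).le)]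
  · simp
  · refine (ae_restrict_mem (measurableSet_Ioi.prod measurableSet_Ioi)).mono fun t ht => ?_
    have := fermiFactor_pos hl (add_pos ht.1 ht.2)
    simpa using this.le
  · exact Measurable.aestronglyMeasurable (by fun_prop)

lemma Aint_eq_toReal {l : ℝ} (hl : 0 < l) :
    Aint l = (∫⁻ s in Set.Ioi (0:ℝ), ENNReal.ofReal (boseWeight s * fermiFactor l s)).toReal := by
  unfold Aint
  simp only [Aint_integrand_eq]
  have hk : ∀ t, 0 < t → 0 ≤ fermiFactor l t / (1 - exp (-t)) := fun t ht =>
    (div_pos (fermiFactor_pos hl ht) (one_sub_exp_neg_pos ht)).le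
  rw [integral_eq_lintegral_of_nonneg_ae, lintegral_quadrant (f := fun t => t)
    (k := fun s => fermiFactor l s / (1 - exp (-s))) continuous_id (fun _ h => h.le)
    (by fun_prop) hk]
  · congr 2
    funext s
    congr 1
    simp [boseWeight]
    ring
  · refine (ae_restrict_mem (measurableSet_Ioi.prod measurableSet_Ioi)).mono fun t ht => ?_
    exact mul_nonneg (le_of_lt ht.1) (hk _ (add_pos ht.1 ht.2))
  · exact Measurable.aestronglyMeasurable (by fun_prop)

lemma lintegral_pow_mul_exp (n : ℕ) {a : ℝ} (ha : 0 < a) :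
    ∫⁻ s in Set.Ioi (0:ℝ), ENNReal.ofReal (s ^ n * exp (-(a * s))) =
      ENNReal.ofReal (n.factorial / a ^ (n + 1)) := by
  have h := integral_rpow_mul_exp_neg_mul_Ioi (a := n + 1) (r := a) (by positivity) ha
  have hint : IntegrableOn (fun x : ℝ => x ^ ((n + 1 : ℝ) - 1) * exp (-(a * x))) (Set.Ioi 0) :=
    .of_integral_ne_zero (by
      rw [h]
      have := Gamma_pos_of_pos (show (0:ℝ) < n + 1 by positivity)
      positivity)
  rw [← ofReal_integral_eq_lintegral_ofReal] at *
  · simp only [add_sub_cancel_right, rpow_natCast] at h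
    rw [h, Gamma_nat_eq_factorial]
    congr 1
    rw [show (n + 1 : ℝ) = ((n + 1 : ℕ) : ℝ) by push_cast; ring, rpow_natCast,
      div_pow, one_pow, one_div_mul_eq_div]
  · simpa only [add_sub_cancel_right, rpow_natCast, IntegrableOn] using hint
  · exact (ae_restrict_mem measurableSet_Ioi).mono fun s hs => by
      have : 0 < s := hs
      positivity

lemma summable_zeta3 : Summable fun k : ℕ => 1 / ((k : ℝ) + 1) ^ 3 := by
  have := (summable_nat_add_iff 1).mpr (Real.summable_one_div_nat_pow.mpr (by norm_num : 1 < 3))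
  simpa using this

lemma lintegral_boseWeight_mul_exp :
    ∫⁻ s in Set.Ioi (0:ℝ), ENNReal.ofReal (boseWeight s * exp (-s)) = ENNReal.ofReal zeta3 := by
  have hexp : ∀ s ∈ Set.Ioi (0:ℝ), ENNReal.ofReal (boseWeight s * exp (-s)) =
      ∑' k : ℕ, ENNReal.ofReal (1 / 2) * ENNReal.ofReal (s ^ 2 * exp (-((k + 1) * s))) := by
    intro s hs
    have h1 := hasSum_geometric_of_lt_one (exp_pos (-s)).le
      (by linarith [one_sub_exp_neg_pos hs] : exp (-s) < 1)
    have h2 := h1.mul_left (s ^ 2 / 2 * exp (-s))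
    have h3 : ∀ k : ℕ, s ^ 2 / 2 * exp (-s) * exp (-s) ^ k =
        1 / 2 * (s ^ 2 * exp (-((k + 1) * s))) := by
      intro k
      rw [← exp_nat_mul, mul_assoc, ← exp_add]
      ring_nf
    simp only [h3] at h2
    simp only [← ENNReal.ofReal_mul (by norm_num : (0:ℝ) ≤ 1 / 2)]
    rw [← ENNReal.ofReal_tsum_of_nonneg (fun k => by positivity) h2.summable, h2.tsum_eq,
      boseWeight]
    congr 1
    ring
  rw [setLIntegral_congr_fun measurableSet_Ioi hexp, lintegral_tsum (fun k => by fun_prop), zeta3,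
    ENNReal.ofReal_tsum_of_nonneg (fun k => by positivity) summable_zeta3]
  refine tsum_congr fun k => ?_
  rw [lintegral_const_mul _ (by fun_prop), lintegral_pow_mul_exp 2 (by positivity),
    ← ENNReal.ofReal_mul (by norm_num)]
  congr 1
  norm_num [Nat.factorial]
  field_simp

lemma zeta3_pos : 0 < zeta3 :=
  summable_zeta3.tsum_pos (fun k => by positivity) 0 (by norm_num)

lemma Aint_one : Aint 1 = zeta3 := by
  rw [Aint_eq_toReal one_pos]
  simp only [fermiFactor_one, lintegral_boseWeight_mul_exp]
  exact ENNReal.toReal_ofReal zeta3_pos.le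

lemma lintegral_id_mul_exp :
    ∫⁻ s in Set.Ioi (0:ℝ), ENNReal.ofReal (s * exp (-s)) = 1 := by
  simpa using lintegral_pow_mul_exp 1 one_pos

lemma Bint_one : Bint 1 = 1 := by
  rw [Bint_eq_toReal one_pos]
  simp [fermiFactor_one, lintegral_id_mul_exp]

lemma lintegral_mul_fermiFactor_ne_top {l : ℝ} (hl : 0 < l) {f : ℝ → ℝ}
    (hf0 : ∀ t, 0 < t → 0 ≤ f t)
    (h : ∫⁻ s in Set.Ioi (0:ℝ), ENNReal.ofReal (f s * exp (-s)) ≠ ⊤) :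
    ∫⁻ s in Set.Ioi (0:ℝ), ENNReal.ofReal (f s * fermiFactor l s) ≠ ⊤ := by
  have hle : ∫⁻ s in Set.Ioi (0:ℝ), ENNReal.ofReal (f s * fermiFactor l s) ≤
      ∫⁻ s in Set.Ioi (0:ℝ), ENNReal.ofReal (max 1 l) * ENNReal.ofReal (f s * exp (-s)) := by
    refine setLIntegral_mono' measurableSet_Ioi fun s hs => ?_
    rw [← ENNReal.ofReal_mul (by positivity)]
    refine ENNReal.ofReal_le_ofReal ?_
    nlinarith [mul_le_mul_of_nonneg_left (fermiFactor_le hl hs) (hf0 s hs)]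
  rw [lintegral_const_mul' _ _ ENNReal.ofReal_ne_top] at hle
  exact ne_top_of_le_ne_top (ENNReal.mul_ne_top ENNReal.ofReal_ne_top h) hle

lemma logistic_pos {l y : ℝ} (hl : 0 < l) (hy : y ∈ Set.Ioo (0:ℝ) 1) :
    0 < l * ((1 - y) / y) :=
  mul_pos hl (div_pos (by linarith [hy.2]) hy.1)

lemma integrable_primitive_and_integral_eq {l : ℝ} (hl : 0 < l) {f : ℝ → ℝ} (hf : Continuous f)
    (hf0 : ∀ t, 0 < t → 0 ≤ f t)
    (h : ∫⁻ s in Set.Ioi (0:ℝ), ENNReal.ofReal (f s * exp (-s)) ≠ ⊤) :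
    IntegrableOn (fun y => ∫ t in (0:ℝ)..log (1 + l * ((1 - y) / y)), f t) (Set.Ioo 0 1) ∧
    (∫⁻ s in Set.Ioi (0:ℝ), ENNReal.ofReal (f s * fermiFactor l s)).toReal =
      ∫ y in Set.Ioo (0:ℝ) 1, ∫ t in (0:ℝ)..log (1 + l * ((1 - y) / y)), f t := by
  have hF : Continuous fun s : ℝ => ∫ t in (0:ℝ)..s, f t :=
    intervalIntegral.continuous_primitive (fun a b => hf.intervalIntegrable a b) 0
  have hm : Measurable fun y => ∫ t in (0:ℝ)..log (1 + l * ((1 - y) / y)), f t :=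
    hF.measurable.comp (g := fun s : ℝ => ∫ t in (0:ℝ)..s, f t)
      (f := fun y => log (1 + l * ((1 - y) / y))) (by fun_prop)
  have hnn : 0 ≤ᵐ[volume.restrict (Set.Ioo (0:ℝ) 1)]
      fun y => ∫ t in (0:ℝ)..log (1 + l * ((1 - y) / y)), f t := by
    refine (ae_restrict_mem measurableSet_Ioo).mono fun y hy => ?_
    refine intervalIntegral.integral_nonneg_of_ae_restrict
      (log_one_add_pos (logistic_pos hl hy)).le ?_
    rw [← restrict_Ioo_eq_restrict_Icc]
    exact (ae_restrict_mem measurableSet_Ioo).mono fun t ht => hf0 t ht.1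
  have hfin := lintegral_mul_fermiFactor_ne_top hl hf0 h
  rw [lintegral_mul_fermiFactor hl hf hf0] at *
  refine ⟨⟨hm.aestronglyMeasurable, ?_⟩, ?_⟩
  · rw [hasFiniteIntegral_iff_ofReal hnn]
    exact hfin.lt_top
  · rw [integral_eq_lintegral_of_nonneg_ae hnn hm.aestronglyMeasurable]

lemma integrableOn_and_Aint_eq {l : ℝ} (hl : 0 < l) :
    IntegrableOn (fun y => bosePrimitive (log (1 + l * ((1 - y) / y)))) (Set.Ioo 0 1) ∧
    Aint l = ∫ y in Set.Ioo (0:ℝ) 1, bosePrimitive (log (1 + l * ((1 - y) / y))) := by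
  rw [Aint_eq_toReal hl]
  exact integrable_primitive_and_integral_eq hl continuous_boseWeight
    (fun t ht => boseWeight_nonneg ht.le)
    (by rw [lintegral_boseWeight_mul_exp]; exact ENNReal.ofReal_ne_top)

lemma integrableOn_and_Bint_eq {l : ℝ} (hl : 0 < l) :
    IntegrableOn (fun y => log (1 + l * ((1 - y) / y)) ^ 2 / 2) (Set.Ioo 0 1) ∧
    Bint l = ∫ y in Set.Ioo (0:ℝ) 1, log (1 + l * ((1 - y) / y)) ^ 2 / 2 := by
  rw [Bint_eq_toReal hl]
  simpa using integrable_primitive_and_integral_eq hl continuous_id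
    (fun t ht => ht.le) (by simp [lintegral_id_mul_exp])

lemma Aint_pos {l : ℝ} (hl : 0 < l) : 0 < Aint l := by
  obtain ⟨hi, he⟩ := integrableOn_and_Aint_eq hl
  have hpos : ∀ y ∈ Set.Ioo (0:ℝ) 1, 0 < bosePrimitive (log (1 + l * ((1 - y) / y))) :=
    fun y hy => bosePrimitive_pos (log_one_add_pos (logistic_pos hl hy))
  rw [he, setIntegral_pos_iff_support_of_nonneg_ae
    ((ae_restrict_mem measurableSet_Ioo).mono fun y hy => (hpos y hy).le) hi,
    Set.inter_eq_right.mpr fun y hy => Function.mem_support.mpr (hpos y hy).ne']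
  simp

lemma Aint_tangent_le {l κ : ℝ} (hl : 0 < l) (hκ : 0 < κ) :
    3 * Aint l - log l * Bint l ≤ κ ^ 2 * Aint 1 + 2 / κ * Aint l := by
  obtain ⟨hiA, hA⟩ := integrableOn_and_Aint_eq hl
  obtain ⟨hiA1, hA1⟩ := integrableOn_and_Aint_eq one_pos
  obtain ⟨hiB, hB⟩ := integrableOn_and_Bint_eq hl
  rw [hA, hA1, hB]
  simp only [← integral_const_mul]
  rw [← integral_sub (hiA.const_mul _) (hiB.const_mul _),
    ← integral_add (hiA1.const_mul _) (hiA.const_mul _)]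
  refine setIntegral_mono_on ((hiA.const_mul _).sub (hiB.const_mul _))
    ((hiA1.const_mul _).add (hiA.const_mul _)) measurableSet_Ioo fun y hy => ?_
  have hr : 0 < (1 - y) / y := by simpa using logistic_pos one_pos hy
  simpa using bosePrimitive_tangent_le hr hl hκ

lemma zeta2_pos : 0 < zeta2 := by unfold zeta2; positivity

/-- `c(1) = (ζ(2)·ζ(3)²)^{−1/3}`, `e(1) = 3·(ζ(3)/ζ(2))^{1/3}`, and `e` attains its maximum
over `(0,∞)` at `λ = 1`. -/
theorem statement3 :
    cfun 1 = (zeta2 * zeta3 ^ 2) ^ (-(1:ℝ)/3) ∧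
    efun 1 = 3 * (zeta3 / zeta2) ^ ((1:ℝ)/3) ∧
    ∀ l : ℝ, 0 < l → efun l ≤ efun 1 := by
  have hz2 := zeta2_pos
  have hz3 := zeta3_pos
  refine ⟨?_, ?_, fun l hl => ?_⟩
  · rw [cfun, Aint_one, Bint_one, neg_div, rpow_neg (by positivity),
      mul_rpow hz2.le (by positivity), ← rpow_natCast, ← rpow_mul hz3.le]
    norm_num
  · rw [efun, Aint_one]
    simp
  · have hA := Aint_pos hl
    have cube_root : ∀ x : ℝ, 0 < x → (x ^ ((1:ℝ)/3)) ^ 3 = x := by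
      intro x hx
      rw [← rpow_natCast, ← rpow_mul hx.le]
      norm_num
    have h23 : Aint l ^ ((2:ℝ)/3) = (Aint l ^ ((1:ℝ)/3)) ^ 2 := by
      rw [← rpow_natCast, ← rpow_mul hA.le]
      norm_num
    simp only [efun, cfun, log_one, mul_zero, sub_zero, Aint_one]
    rw [div_rpow hA.le hz2.le, div_rpow hz3.le hz2.le, h23]
    have ha := cube_root _ hA
    have ha0 := cube_root _ hz3
    have hapos : 0 < Aint l ^ ((1:ℝ)/3) := rpow_pos_of_pos hA _
    have ha0pos : 0 < zeta3 ^ ((1:ℝ)/3) := rpow_pos_of_pos hz3 _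
    have hzpos : 0 < zeta2 ^ ((1:ℝ)/3) := rpow_pos_of_pos hz2 _
    set a := Aint l ^ ((1:ℝ)/3)
    set a0 := zeta3 ^ ((1:ℝ)/3)
    set z := zeta2 ^ ((1:ℝ)/3)
    have h := Aint_tangent_le hl (div_pos hapos ha0pos)
    rw [Aint_one, ← ha, ← ha0] at h
    have e1 : (a / a0) ^ 2 * a0 ^ 3 + 2 / (a / a0) * a ^ 3 = 3 * a0 * a ^ 2 := by
      field_simp
      ring
    rw [e1] at h
    have e2 : 3 * (a / z) - Bint l / (z * a ^ 2) * log l =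
        (3 * a ^ 3 - log l * Bint l) / (z * a ^ 2) := by
      field_simp
    have e3 : 3 * (a0 / z) = 3 * a0 * a ^ 2 / (z * a ^ 2) := by
      field_simp
    rw [e2, e3]
    gcongr
end

section
/- As n → ∞, the maximal number of vertices of a convex chain joining 0 to (n,n), i.e. max{ card(supp ν) : ν finitely supported on X with endpoint (n,n) }, is asymptotically equivalent to 3·(n/π)^{2/3}. -/
open Real Filter Asymptotics

/-- The set of pairs of coprime nonnegative integers (including `(0,1)` and `(1,0)`). -/
abbrev Xc : Type := {x : ℕ × ℕ // Nat.gcd x.1 x.2 = 1}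

/-- The endpoint of the convex chain encoded by a finitely supported `ν : X →₀ ℕ`. -/
def chainEndpoint (ν : Xc →₀ ℕ) : ℕ × ℕ :=
  (ν.sum fun x m => m * x.val.1, ν.sum fun x m => m * x.val.2)

/-- The maximal number of vertices of a convex chain joining `0` to `(n,n)`. -/
noncomputable def maxVertices (n : ℕ) : ℕ :=
  sSup {k : ℕ | ∃ ν : Xc →₀ ℕ, chainEndpoint ν = (n, n) ∧ ν.support.card = k}


open ArithmeticFunction in
theorem sum_totient_eq_sum_moebius (N : ℕ) :
    ∑ n ∈ Finset.Ioc 0 N, (n.totient : ℝ) =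
      ∑ d ∈ Finset.Ioc 0 N, (moebius d : ℝ) * (((N / d : ℕ) : ℝ) * ((N / d : ℕ) + 1) / 2) := by
  have htot : ∀ n > 0, ∑ x ∈ n.divisorsAntidiagonal, (moebius x.1 : ℝ) * (x.2 : ℝ) =
      (n.totient : ℝ) := by
    refine (sum_eq_iff_sum_mul_moebius_eq (f := fun n => (n.totient : ℝ))
      (g := fun n => (n : ℝ))).1 fun n _ => ?_
    exact_mod_cast Nat.sum_totient n
  have hgauss : ∀ q : ℕ, ∑ m ∈ Finset.Ioc 0 q, (m : ℝ) = (q : ℝ) * (q + 1) / 2 := by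
    intro q
    induction q with
    | zero => simp
    | succ q ih =>
      rw [Finset.sum_Ioc_succ_top (Nat.zero_le q), ih]
      push_cast
      ring
  have h := sum_Ioc_mul_eq_sum_sum (R := ℝ) (moebius : ArithmeticFunction ℝ)
    ((ArithmeticFunction.id : ArithmeticFunction ℕ) : ArithmeticFunction ℝ) N
  simp only [mul_apply, intCoe_apply, natCoe_apply, id_apply, hgauss] at h
  rw [← h]
  exact Finset.sum_congr rfl fun n hn => (htot n (Finset.mem_Ioc.1 hn).1).symm

open ArithmeticFunction in
theorem tsum_moebius_div_sq : ∑' d : ℕ, (moebius d : ℝ) / (d : ℝ) ^ 2 = 6 / π ^ 2 := by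
  have h2 : (1 : ℝ) < (2 : ℂ).re := by norm_num
  have h := LSeries_zeta_mul_Lseries_moebius h2
  rw [LSeries_zeta_eq_riemannZeta h2, riemannZeta_two] at h
  have hL : LSeries (fun n => ((moebius n : ℤ) : ℂ)) 2 =
      ((∑' d : ℕ, (moebius d : ℝ) / (d : ℝ) ^ 2 : ℝ) : ℂ) := by
    rw [LSeries, Complex.ofReal_tsum]
    refine tsum_congr fun n => ?_
    rcases eq_or_ne n 0 with rfl | hn
    · simp
    · rw [LSeries.term_of_ne_zero hn]
      push_cast
      norm_cast
  rw [hL] at h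
  have hr : π ^ 2 / 6 * ∑' d : ℕ, (moebius d : ℝ) / (d : ℝ) ^ 2 = 1 := by exact_mod_cast h
  have := Real.pi_pos
  field_simp at hr ⊢
  linarith

theorem tendsto_natCast_div_div (d : ℕ) :
    Tendsto (fun N : ℕ => ((N / d : ℕ) : ℝ) / N) atTop (nhds ((d : ℝ)⁻¹)) := by
  rcases eq_or_ne d 0 with rfl | hd
  · simp
  · have hd' : (0 : ℝ) < d := by positivity
    have h := (tendsto_nat_floor_mul_div_atTop (R := ℝ) (a := (d : ℝ)⁻¹)
      (by positivity)).comp tendsto_natCast_atTop_atTop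
    refine h.congr fun N => ?_
    simp only [Function.comp]
    rw [inv_mul_eq_div, Nat.floor_div_eq_div]

open ArithmeticFunction in
theorem tendsto_sum_totient_div_sq :
    Tendsto (fun N : ℕ => (∑ n ∈ Finset.Ioc 0 N, (n.totient : ℝ)) / (N : ℝ) ^ 2) atTop
      (nhds (3 / π ^ 2)) := by
  have hlim : ∑' d : ℕ, (moebius d : ℝ) * ((d : ℝ)⁻¹ * ((d : ℝ)⁻¹ + 0) / 2) = 3 / π ^ 2 := by
    have : ∀ d : ℕ, (moebius d : ℝ) * ((d : ℝ)⁻¹ * ((d : ℝ)⁻¹ + 0) / 2) =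
        (moebius d : ℝ) / (d : ℝ) ^ 2 * (1 / 2) := by
      intro d
      ring
    simp_rw [this]
    rw [tsum_mul_right, tsum_moebius_div_sq]
    ring
  rw [← hlim]
  have hT := tendsto_tsum_of_dominated_convergence (𝓕 := (atTop : Filter ℕ))
    (f := fun (N d : ℕ) => (moebius d : ℝ) *
      ((((N / d : ℕ) : ℝ) / N) * (((N / d : ℕ) : ℝ) / N + (N : ℝ)⁻¹) / 2))
    (g := fun d : ℕ => (moebius d : ℝ) * ((d : ℝ)⁻¹ * ((d : ℝ)⁻¹ + 0) / 2))
    (bound := fun d : ℕ => ((d : ℝ) ^ 2)⁻¹)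
    (Real.summable_nat_pow_inv.2 one_lt_two) ?_ ?_
  · refine hT.congr fun N => ?_
    rw [sum_totient_eq_sum_moebius, Finset.sum_div, tsum_eq_sum (s := Finset.Ioc 0 N)]
    · refine Finset.sum_congr rfl fun d hd => ?_
      have : (0 : ℝ) < N := by
        have := Finset.mem_Ioc.1 hd
        exact_mod_cast this.1.trans_le this.2
      field_simp
    · intro d hd
      have : N / d = 0 := by
        rw [Nat.div_eq_zero_iff]
        simp only [Finset.mem_Ioc] at hd
        omega
      simp [this]
  · intro d
    exact ((((tendsto_natCast_div_div d).mul ((tendsto_natCast_div_div d).add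
      (tendsto_inv_atTop_nhds_zero_nat (𝕜 := ℝ)))).div_const 2).const_mul _)
  · filter_upwards [eventually_gt_atTop 0] with N hN d
    have hN' : (0 : ℝ) < N := by exact_mod_cast hN
    have hmu : ‖(moebius d : ℝ)‖ ≤ 1 := by
      rw [Real.norm_eq_abs]
      exact_mod_cast abs_moebius_le_one (n := d)
    have hq : ((N / d : ℕ) : ℝ) / N ≤ (d : ℝ)⁻¹ := by
      rw [div_le_iff₀ hN', inv_mul_eq_div]
      exact Nat.cast_div_le
    have hq0 : (0 : ℝ) ≤ ((N / d : ℕ) : ℝ) / N := by positivity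
    have hsq : ((N / d : ℕ) : ℝ) ≤ ((N / d : ℕ) : ℝ) ^ 2 := by
      exact_mod_cast Nat.le_self_pow two_ne_zero _
    have hb : (((N / d : ℕ) : ℝ) / N) * (((N / d : ℕ) : ℝ) / N + (N : ℝ)⁻¹) / 2 ≤
        (((N / d : ℕ) : ℝ) / N) ^ 2 := by
      rw [div_pow, ← one_div, ← add_div, div_mul_div_comm, div_div, div_le_div_iff₀ (by positivity)
        (by positivity)]
      have := mul_le_mul_of_nonneg_right hsq (sq_nonneg (N : ℝ))
      nlinarith
    rw [norm_mul, Real.norm_of_nonneg (by positivity :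
      0 ≤ (((N / d : ℕ) : ℝ) / N) * (((N / d : ℕ) : ℝ) / N + (N : ℝ)⁻¹) / 2)]
    calc _ ≤ 1 * (((N / d : ℕ) : ℝ) / N) ^ 2 := by gcongr
      _ ≤ ((d : ℝ) ^ 2)⁻¹ := by
        rw [one_mul, ← inv_pow]
        gcongr

theorem card_coprime_antidiagonal {s : ℕ} (hs : 2 ≤ s) :
    ((Finset.HasAntidiagonal.antidiagonal s).filter fun x => Nat.gcd x.1 x.2 = 1).card = s.totient := by
  rw [Nat.totient, Finset.card_filter, Finset.Nat.sum_antidiagonal_eq_sum_range_succ_mk,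
    ← Finset.card_filter]
  congr 1
  ext i
  simp only [Finset.mem_filter, Finset.mem_range, Nat.lt_succ_iff]
  constructor
  · rintro ⟨hi, h⟩
    have hne : i ≠ s := by
      rintro rfl
      simp at h
      omega
    refine ⟨by omega, ?_⟩
    rw [Nat.coprime_comm, Nat.Coprime, ← h, Nat.gcd_sub_self_right hi]
  · rintro ⟨hi, h⟩
    refine ⟨hi.le, ?_⟩
    rw [Nat.gcd_sub_self_right hi.le, Nat.gcd_comm]
    exact h

/-- The `ℓ¹` norm of a primitive vector. -/
def height (x : Xc) : ℕ := x.val.1 + x.val.2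

/-- The primitive vectors of height at most `t`. -/
def heightBall (t : ℕ) : Finset Xc :=
  ((Finset.range (t + 1) ×ˢ Finset.range (t + 1)).filter fun x => x.1 + x.2 ≤ t).subtype _

theorem mem_heightBall {t : ℕ} {x : Xc} : x ∈ heightBall t ↔ height x ≤ t := by
  simp only [heightBall, height, Finset.mem_subtype, Finset.mem_filter, Finset.mem_product,
    Finset.mem_range]
  omega

/-- The primitive vectors of height exactly `s`. -/
def heightSphere (s : ℕ) : Finset Xc := (Finset.HasAntidiagonal.antidiagonal s).subtype _

theorem mem_heightSphere {s : ℕ} {x : Xc} : x ∈ heightSphere s ↔ height x = s := by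
  simp [heightSphere, height]

theorem card_heightSphere {s : ℕ} (hs : 2 ≤ s) : (heightSphere s).card = s.totient := by
  rw [heightSphere, Finset.card_subtype, card_coprime_antidiagonal hs]

theorem heightBall_succ (t : ℕ) :
    heightBall (t + 1) = (heightBall t).disjUnion (heightSphere (t + 1))
      (Finset.disjoint_left.2 fun x hx hx' => by
        rw [mem_heightBall] at hx
        rw [mem_heightSphere] at hx'
        omega) := by
  ext x
  rw [Finset.mem_disjUnion, mem_heightBall, mem_heightBall, mem_heightSphere]
  omega

theorem card_heightBall {t : ℕ} (ht : 1 ≤ t) :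
    (heightBall t).card = ∑ s ∈ Finset.Ioc 0 t, s.totient + 1 := by
  induction t, ht using Nat.le_induction with
  | base => decide
  | succ t ht ih =>
    rw [heightBall_succ, Finset.card_disjUnion, ih, card_heightSphere (by omega),
      Finset.sum_Ioc_succ_top (Nat.zero_le t)]
    ring

theorem sum_heightBall_sub (t : ℕ) :
    ∑ x ∈ heightBall t, (t - height x) = ∑ s ∈ Finset.range t, (heightBall s).card := by
  induction t with
  | zero => simp
  | succ t ih =>
    rw [heightBall_succ, Finset.sum_disjUnion, Finset.sum_range_succ, ← ih, Finset.card_eq_sum_ones,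
      ← Finset.sum_add_distrib]
    have h0 : ∑ x ∈ heightSphere (t + 1), (t + 1 - height x) = 0 :=
      Finset.sum_eq_zero fun x hx => by rw [mem_heightSphere.1 hx, Nat.sub_self]
    rw [h0, add_zero]
    refine Finset.sum_congr rfl fun x hx => ?_
    have := mem_heightBall.1 hx
    omega

theorem mul_card_support_le {ν : Xc →₀ ℕ} {n : ℕ} (hν : chainEndpoint ν = (n, n)) (t : ℕ) :
    t * ν.support.card ≤ 2 * n + ∑ s ∈ Finset.range t, (heightBall s).card := by
  obtain ⟨h1, h2⟩ := Prod.ext_iff.1 hν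
  simp only [chainEndpoint, Finsupp.sum] at h1 h2
  have hsum : ∑ x ∈ ν.support, height x ≤ 2 * n := by
    rw [two_mul]
    nth_rewrite 1 [← h1]
    rw [← h2, ← Finset.sum_add_distrib]
    refine Finset.sum_le_sum fun x hx => ?_
    rw [← mul_add]
    exact Nat.le_mul_of_pos_left _ (Nat.pos_of_ne_zero (Finsupp.mem_support_iff.1 hx))
  have hdef : ∑ x ∈ ν.support, (t - height x) ≤ ∑ x ∈ heightBall t, (t - height x) :=
    Finset.sum_le_sum_of_ne_zero fun x _ hx => mem_heightBall.2 (by omega)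
  rw [← sum_heightBall_sub]
  calc t * ν.support.card = ∑ x ∈ ν.support, t := by
        rw [Finset.sum_const, smul_eq_mul, mul_comm]
    _ ≤ ∑ x ∈ ν.support, (height x + (t - height x)) :=
        Finset.sum_le_sum fun x _ => by omega
    _ ≤ _ := by
        rw [Finset.sum_add_distrib]
        exact add_le_add hsum hdef

theorem sum_heightBall_fst_eq_snd (t : ℕ) :
    ∑ x ∈ heightBall t, x.val.1 = ∑ x ∈ heightBall t, x.val.2 := by
  refine Finset.sum_bij' (fun x _ => ⟨x.val.swap, by
      rw [Prod.fst_swap, Prod.snd_swap, Nat.gcd_comm]; exact x.2⟩)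
    (fun x _ => ⟨x.val.swap, by
      rw [Prod.fst_swap, Prod.snd_swap, Nat.gcd_comm]; exact x.2⟩) ?_ ?_ ?_ ?_ ?_ <;>
  simp [mem_heightBall, height, add_comm]

theorem mul_card_heightBall (t : ℕ) :
    t * (heightBall t).card =
      2 * ∑ x ∈ heightBall t, x.val.1 + ∑ s ∈ Finset.range t, (heightBall s).card := by
  rw [two_mul]
  nth_rewrite 2 [sum_heightBall_fst_eq_snd]
  rw [← sum_heightBall_sub, ← Finset.sum_add_distrib, ← Finset.sum_add_distrib, mul_comm,
    ← smul_eq_mul, ← Finset.sum_const]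
  refine Finset.sum_congr rfl fun x hx => ?_
  have := mem_heightBall.1 hx
  simp only [height] at *
  omega

theorem chainEndpoint_add (ν₁ ν₂ : Xc →₀ ℕ) :
    chainEndpoint (ν₁ + ν₂) = chainEndpoint ν₁ + chainEndpoint ν₂ := by
  simp only [chainEndpoint, Prod.mk_add_mk]
  rw [Finsupp.sum_add_index' (by simp) (by simp [add_mul]),
    Finsupp.sum_add_index' (by simp) (by simp [add_mul])]

theorem chainEndpoint_single (x : Xc) (m : ℕ) :
    chainEndpoint (Finsupp.single x m) = (m * x.val.1, m * x.val.2) := by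
  simp [chainEndpoint]

theorem chainEndpoint_indicator_one (s : Finset Xc) :
    chainEndpoint (Finsupp.indicator s fun _ _ => 1) =
      (∑ x ∈ s, x.val.1, ∑ x ∈ s, x.val.2) := by
  rw [chainEndpoint, Finsupp.sum_of_support_subset _ (Finsupp.support_indicator_subset _ _) _
    (by simp), Finsupp.sum_of_support_subset _ (Finsupp.support_indicator_subset _ _) _ (by simp)]
  refine Prod.ext (Finset.sum_congr rfl fun x hx => ?_) (Finset.sum_congr rfl fun x hx => ?_) <;>
  simp [Finsupp.indicator_of_mem hx]

theorem bddAbove_card_support (n : ℕ) :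
    BddAbove {k : ℕ | ∃ ν : Xc →₀ ℕ, chainEndpoint ν = (n, n) ∧ ν.support.card = k} := by
  refine ⟨2 * n + ∑ s ∈ Finset.range 1, (heightBall s).card, ?_⟩
  rintro k ⟨ν, hν, rfl⟩
  simpa only [one_mul] using mul_card_support_le hν 1

theorem mul_maxVertices_le (n t : ℕ) :
    t * maxVertices n ≤ 2 * n + ∑ s ∈ Finset.range t, (heightBall s).card := by
  have hmem : maxVertices n ∈
      {k : ℕ | ∃ ν : Xc →₀ ℕ, chainEndpoint ν = (n, n) ∧ ν.support.card = k} := by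
    refine Nat.sSup_mem ⟨_, Finsupp.single ⟨(1, 0), by simp⟩ n + Finsupp.single ⟨(0, 1), by simp⟩ n,
      ?_, rfl⟩ (bddAbove_card_support n)
    simp [chainEndpoint_add, chainEndpoint_single]
  obtain ⟨ν, hν, hk⟩ := hmem
  rw [← hk]
  exact mul_card_support_le hν t

theorem card_heightBall_le_maxVertices {n t : ℕ}
    (h : t * (heightBall t).card ≤ 2 * n + ∑ s ∈ Finset.range t, (heightBall s).card) :
    (heightBall t).card ≤ maxVertices n := by
  set m := ∑ x ∈ heightBall t, x.val.1 with hm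
  have hmn : m ≤ n := by
    rw [mul_card_heightBall] at h
    omega
  set ν : Xc →₀ ℕ := Finsupp.indicator (heightBall t) (fun _ _ => 1) +
    (Finsupp.single ⟨(1, 0), by simp⟩ (n - m) + Finsupp.single ⟨(0, 1), by simp⟩ (n - m)) with hν
  have hend : chainEndpoint ν = (n, n) := by
    rw [hν, chainEndpoint_add, chainEndpoint_indicator_one, ← sum_heightBall_fst_eq_snd, ← hm,
      chainEndpoint_add, chainEndpoint_single, chainEndpoint_single]
    simp [hmn]
  have hsub : heightBall t ⊆ ν.support := by
    intro x hx
    rw [Finsupp.mem_support_iff, hν, Finsupp.add_apply, Finsupp.indicator_of_mem hx]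
    omega
  exact (Finset.card_le_card hsub).trans (le_csSup (bddAbove_card_support n) ⟨ν, hend, rfl⟩)

theorem tendsto_card_heightBall_div_sq :
    Tendsto (fun t : ℕ => ((heightBall t).card : ℝ) / (t : ℝ) ^ 2) atTop (nhds (3 / π ^ 2)) := by
  have h0 : Tendsto (fun t : ℕ => ((t : ℝ)⁻¹) ^ 2) atTop (nhds (0 ^ 2)) :=
    (tendsto_inv_atTop_nhds_zero_nat (𝕜 := ℝ)).pow 2
  have h := tendsto_sum_totient_div_sq.add h0
  rw [zero_pow two_ne_zero, add_zero] at h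
  refine h.congr' ?_
  filter_upwards [eventually_ge_atTop 1] with t ht
  rw [card_heightBall ht, inv_pow, ← one_div, ← add_div]
  push_cast
  rfl

theorem sum_range_sq (t : ℕ) :
    ∑ s ∈ Finset.range t, (s : ℝ) ^ 2 = (t : ℝ) ^ 3 / 3 - (t : ℝ) ^ 2 / 2 + t / 6 := by
  induction t with
  | zero => simp
  | succ t ih =>
    rw [Finset.sum_range_succ, ih]
    push_cast
    ring

theorem tendsto_sum_range_sq_div_cube :
    Tendsto (fun t : ℕ => (∑ s ∈ Finset.range t, (s : ℝ) ^ 2) / (t : ℝ) ^ 3) atTop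
      (nhds (1 / 3)) := by
  have hi := tendsto_inv_atTop_nhds_zero_nat (𝕜 := ℝ)
  have h : Tendsto (fun t : ℕ => 1 / 3 - (t : ℝ)⁻¹ / 2 + ((t : ℝ)⁻¹) ^ 2 / 6) atTop
      (nhds (1 / 3 - 0 / 2 + 0 ^ 2 / 6)) :=
    (tendsto_const_nhds.sub (hi.div_const 2)).add ((hi.pow 2).div_const 6)
  norm_num at h
  norm_num
  refine h.congr' ?_
  filter_upwards [eventually_gt_atTop 0] with t ht
  have : (0 : ℝ) < t := by exact_mod_cast ht
  rw [sum_range_sq]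
  field_simp

/-- If `f s / s ^ 2` converges to `c`, then `(∑ s < t, f s) / t ^ 3` converges to `c / 3`. -/
theorem tendsto_sum_range_div_cube {f : ℕ → ℝ} {c : ℝ}
    (hf : Tendsto (fun s : ℕ => f s / (s : ℝ) ^ 2) atTop (nhds c)) :
    Tendsto (fun t : ℕ => (∑ s ∈ Finset.range t, f s) / (t : ℝ) ^ 3) atTop (nhds (c / 3)) := by
  have hsq := tendsto_sum_range_sq_div_cube
  have hlittle : (fun s : ℕ => f s - c * (s : ℝ) ^ 2) =o[atTop] fun s : ℕ => (s : ℝ) ^ 2 := by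
    refine (isLittleO_iff_tendsto' ?_).2 ?_
    · filter_upwards [eventually_gt_atTop 0] with s hs h
      have : (0 : ℝ) < s := by exact_mod_cast hs
      exact absurd h (by positivity)
    · have h := hf.sub_const c
      rw [sub_self] at h
      refine h.congr' ?_
      filter_upwards [eventually_gt_atTop 0] with s hs
      have : (0 : ℝ) < s := by exact_mod_cast hs
      field_simp
  have hcube : Tendsto (fun t : ℕ => (t : ℝ) ^ 3) atTop atTop :=
    (tendsto_pow_atTop three_ne_zero).comp tendsto_natCast_atTop_atTop
  have htop : Tendsto (fun t : ℕ => ∑ s ∈ Finset.range t, (s : ℝ) ^ 2) atTop atTop := by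
    refine (hsq.pos_mul_atTop (by norm_num) hcube).congr' ?_
    filter_upwards [eventually_gt_atTop 0] with t ht
    have : (0 : ℝ) < t := by exact_mod_cast ht
    field_simp
  have hsum := (hlittle.sum_range (fun s => sq_nonneg (s : ℝ)) htop).tendsto_div_nhds_zero
  have h := (hsum.mul hsq).add (hsq.const_mul c)
  rw [zero_mul, zero_add, mul_one_div] at h
  refine h.congr' ?_
  filter_upwards [eventually_gt_atTop 0, htop.eventually_gt_atTop 0] with t ht ht'
  have : (0 : ℝ) < t := by exact_mod_cast ht
  rw [Finset.sum_sub_distrib, ← Finset.mul_sum]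
  field_simp
  ring

theorem tendsto_sum_card_heightBall_div_cube :
    Tendsto (fun t : ℕ => (∑ s ∈ Finset.range t, ((heightBall s).card : ℝ)) / (t : ℝ) ^ 3) atTop
      (nhds (1 / π ^ 2)) := by
  have h := tendsto_sum_range_div_cube tendsto_card_heightBall_div_sq
  rwa [div_right_comm, div_self three_ne_zero] at h

theorem tendsto_cbrt_natCast_atTop :
    Tendsto (fun n : ℕ => (n : ℝ) ^ ((1 : ℝ) / 3)) atTop atTop :=
  (tendsto_rpow_atTop (by norm_num)).comp tendsto_natCast_atTop_atTop

theorem rpow_one_third_pow_three {x : ℝ} (hx : 0 ≤ x) : (x ^ ((1 : ℝ) / 3)) ^ 3 = x := by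
  rw [← Real.rpow_natCast, ← Real.rpow_mul hx]
  norm_num

theorem tendsto_floor_mul_cbrt_div {a : ℝ} (ha : 0 ≤ a) :
    Tendsto (fun n : ℕ => ((⌊a * (n : ℝ) ^ ((1 : ℝ) / 3)⌋₊ : ℕ) : ℝ) / (n : ℝ) ^ ((1 : ℝ) / 3))
      atTop (nhds a) :=
  (tendsto_nat_floor_mul_div_atTop ha).comp tendsto_cbrt_natCast_atTop

theorem tendsto_floor_mul_cbrt_atTop {a : ℝ} (ha : 0 < a) :
    Tendsto (fun n : ℕ => ⌊a * (n : ℝ) ^ ((1 : ℝ) / 3)⌋₊) atTop atTop :=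
  tendsto_nat_floor_atTop.comp (tendsto_cbrt_natCast_atTop.const_mul_atTop ha)

/-- Upper bound for `maxVertices`, with a free parameter `a > 0`. -/
theorem eventually_maxVertices_div_lt {a y : ℝ} (ha : 0 < a) (hy : 2 / a + a ^ 2 / π ^ 2 < y) :
    ∀ᶠ n : ℕ in atTop, (maxVertices n : ℝ) / ((n : ℝ) ^ ((1 : ℝ) / 3)) ^ 2 < y := by
  have hS := tendsto_sum_card_heightBall_div_cube.comp (tendsto_floor_mul_cbrt_atTop ha)
  have hr := tendsto_floor_mul_cbrt_div ha.le
  have h := ((hr.inv₀ ha.ne').const_mul 2).add (hS.mul (hr.pow 2))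
  rw [← div_eq_mul_inv, one_div_mul_eq_div] at h
  filter_upwards [h.eventually_lt_const hy, tendsto_cbrt_natCast_atTop.eventually_gt_atTop 0,
    (tendsto_floor_mul_cbrt_atTop ha).eventually_gt_atTop 0] with n hn hr0 ht0
  refine lt_of_le_of_lt ?_ hn
  simp only [Function.comp]
  have hn3 := rpow_one_third_pow_three (Nat.cast_nonneg (α := ℝ) n)
  set r := (n : ℝ) ^ ((1 : ℝ) / 3)
  set t := ⌊a * r⌋₊
  have ht : (0 : ℝ) < t := by exact_mod_cast ht0
  have hM : (t : ℝ) * maxVertices n ≤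
      2 * r ^ 3 + ∑ s ∈ Finset.range t, ((heightBall s).card : ℝ) := by
    rw [hn3]
    exact_mod_cast mul_maxVertices_le n t
  calc (maxVertices n : ℝ) / r ^ 2 = t * maxVertices n / (t * r ^ 2) := by field_simp
    _ ≤ (2 * r ^ 3 + ∑ s ∈ Finset.range t, ((heightBall s).card : ℝ)) / (t * r ^ 2) := by gcongr
    _ = 2 * (t / r)⁻¹ +
        (∑ s ∈ Finset.range t, ((heightBall s).card : ℝ)) / (t : ℝ) ^ 3 * (t / r) ^ 2 := by
      generalize ∑ s ∈ Finset.range t, ((heightBall s).card : ℝ) = S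
      field_simp

/-- Lower bound for `maxVertices`, with a free parameter `a > 0` such that `a ^ 3 < π ^ 2`. -/
theorem eventually_lt_maxVertices_div {a y : ℝ} (ha : 0 < a) (ha' : a ^ 3 < π ^ 2)
    (hy : y < 3 * a ^ 2 / π ^ 2) :
    ∀ᶠ n : ℕ in atTop, y < (maxVertices n : ℝ) / ((n : ℝ) ^ ((1 : ℝ) / 3)) ^ 2 := by
  have hS := tendsto_sum_card_heightBall_div_cube.comp (tendsto_floor_mul_cbrt_atTop ha)
  have hC := tendsto_card_heightBall_div_sq.comp (tendsto_floor_mul_cbrt_atTop ha)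
  have hr := tendsto_floor_mul_cbrt_div ha.le
  have hlow := hC.mul (hr.pow 2)
  have hfit := (hC.sub hS).mul (hr.pow 3)
  have hlt : (3 / π ^ 2 - 1 / π ^ 2) * a ^ 3 < 2 := by
    rw [← sub_div, div_mul_eq_mul_div, div_lt_iff₀ (by positivity)]
    linarith
  rw [mul_div_right_comm] at hy
  filter_upwards [hlow.eventually_const_lt hy, hfit.eventually_lt_const hlt,
    tendsto_cbrt_natCast_atTop.eventually_gt_atTop 0,
    (tendsto_floor_mul_cbrt_atTop ha).eventually_gt_atTop 0] with n hn hn' hr0 ht0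
  refine hn.trans_le ?_
  simp only [Function.comp] at hn' ⊢
  have hn3 := rpow_one_third_pow_three (Nat.cast_nonneg (α := ℝ) n)
  set r := (n : ℝ) ^ ((1 : ℝ) / 3)
  set t := ⌊a * r⌋₊
  have ht : (0 : ℝ) < t := by exact_mod_cast ht0
  have hle : (t : ℝ) * (heightBall t).card ≤
      2 * n + ∑ s ∈ Finset.range t, ((heightBall s).card : ℝ) := by
    rw [← hn3, ← sub_le_iff_le_add]
    have : (((heightBall t).card : ℝ) / (t : ℝ) ^ 2 -
        (∑ s ∈ Finset.range t, ((heightBall s).card : ℝ)) / (t : ℝ) ^ 3) * (t / r) ^ 3 =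
        (t * (heightBall t).card - ∑ s ∈ Finset.range t, ((heightBall s).card : ℝ)) / r ^ 3 := by
      field_simp
    rw [this, div_lt_iff₀ (by positivity)] at hn'
    exact hn'.le
  have hM : ((heightBall t).card : ℝ) ≤ maxVertices n := by
    exact_mod_cast card_heightBall_le_maxVertices (by exact_mod_cast hle)
  calc ((heightBall t).card : ℝ) / (t : ℝ) ^ 2 * (t / r) ^ 2 = (heightBall t).card / r ^ 2 := by
        field_simp
    _ ≤ _ := by gcongr

theorem tendsto_maxVertices_div :
    Tendsto (fun n : ℕ => (maxVertices n : ℝ) / ((n : ℝ) ^ ((1 : ℝ) / 3)) ^ 2) atTop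
      (nhds (3 / (π ^ ((1 : ℝ) / 3)) ^ 2)) := by
  have hp : 0 < π ^ ((1 : ℝ) / 3) := Real.rpow_pos_of_pos Real.pi_pos _
  have hp3 := rpow_one_third_pow_three Real.pi_pos.le
  set p := π ^ ((1 : ℝ) / 3)
  refine tendsto_order.2 ⟨fun y hy => ?_, fun y hy => ?_⟩
  · have hcont : Tendsto (fun a : ℝ => 3 * a ^ 2 / π ^ 2) (nhdsWithin (p ^ 2) (Set.Iio (p ^ 2)))
        (nhds (3 * (p ^ 2) ^ 2 / π ^ 2)) :=
      ((by fun_prop : Continuous fun a : ℝ => 3 * a ^ 2 / π ^ 2).tendsto _).mono_left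
        nhdsWithin_le_nhds
    have hval : 3 * (p ^ 2) ^ 2 / π ^ 2 = 3 / p ^ 2 := by
      rw [← hp3]
      field_simp
    rw [hval] at hcont
    obtain ⟨a, hya, ha0, ha⟩ := ((hcont.eventually_const_lt hy).and
      (Ioo_mem_nhdsLT (by positivity : 0 < p ^ 2))).exists
    refine eventually_lt_maxVertices_div ha0 ?_ hya
    calc a ^ 3 < (p ^ 2) ^ 3 := by gcongr
      _ = π ^ 2 := by rw [← hp3]; ring
  · refine eventually_maxVertices_div_lt (a := p ^ 2) (by positivity) (lt_of_eq_of_lt ?_ hy)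
    rw [← hp3]
    field_simp
    norm_num

/-- The maximal number of vertices of a convex chain joining `0` to `(n,n)` is
asymptotically equivalent to `3·(n/π)^{2/3}`. -/
theorem statement5 :
    (fun n : ℕ => (maxVertices n : ℝ))
      ~[atTop] (fun n : ℕ => 3 * ((n : ℝ) / π) ^ ((2:ℝ)/3)) := by
  have hp : 0 < π ^ ((1 : ℝ) / 3) := Real.rpow_pos_of_pos Real.pi_pos _
  have hpow : ∀ x : ℝ, 0 ≤ x → x ^ ((2 : ℝ) / 3) = (x ^ ((1 : ℝ) / 3)) ^ 2 := by
    intro x hx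
    rw [← Real.rpow_natCast, ← Real.rpow_mul hx]
    norm_num
  have heq : (fun n : ℕ => 3 * ((n : ℝ) / π) ^ ((2 : ℝ) / 3)) =
      fun n : ℕ => 3 / (π ^ ((1 : ℝ) / 3)) ^ 2 * ((n : ℝ) ^ ((1 : ℝ) / 3)) ^ 2 := by
    funext n
    rw [hpow _ (by positivity), Real.div_rpow (Nat.cast_nonneg n) Real.pi_pos.le, div_pow]
    ring
  have hpos := tendsto_cbrt_natCast_atTop.eventually_gt_atTop 0
  rw [heq]
  refine (isEquivalent_iff_tendsto_one ?_).2 ?_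
  · filter_upwards [hpos] with n hn
    positivity
  · have h := tendsto_maxVertices_div.div_const (3 / (π ^ ((1 : ℝ) / 3)) ^ 2)
    rw [div_self (by positivity)] at h
    refine h.congr fun n => ?_
    rw [Pi.div_apply, div_div, mul_comm]
end

section
/- As λ → +∞, c(λ) converges to 3·π^{−2/3} and e(λ) converges to 0. -/
open Real Filter MeasureTheory

theorem setIntegral_quadrant_mul_comp_add {w W g : ℝ → ℝ} (hw : Measurable w) (hg : Measurable g)
    (hw0 : ∀ t, 0 < t → 0 ≤ w t) (hg0 : ∀ s, 0 < s → 0 ≤ g s) (hW : Measurable W)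
    (hW0 : ∀ s, 0 < s → 0 ≤ W s)
    (hwW : ∀ s, 0 < s → ∫⁻ t in Set.Ioo 0 s, ENNReal.ofReal (w t) = ENNReal.ofReal (W s)) :
    ∫ t : ℝ × ℝ in Set.Ioi (0:ℝ) ×ˢ Set.Ioi (0:ℝ), w t.1 * g (t.1 + t.2) =
      ∫ s in Set.Ioi (0:ℝ), W s * g s := by
  have hS : MeasurableSet (Set.Ioi (0:ℝ) ×ˢ Set.Ioi (0:ℝ)) := measurableSet_Ioi.prod measurableSet_Ioi
  have hm : Measurable fun t : ℝ × ℝ => w t.1 * g (t.1 + t.2) := by fun_prop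
  have hlin : ∀ a b : ℝ, 0 < a → ENNReal.ofReal (w a * b) =
      ENNReal.ofReal (w a) * ENNReal.ofReal b := fun a b ha => ENNReal.ofReal_mul (hw0 a ha)
  rw [integral_eq_lintegral_of_nonneg_ae, integral_eq_lintegral_of_nonneg_ae]
  · congr 1
    rw [Measure.volume_eq_prod, setLIntegral_prod _ (by fun_prop)]
    have inner : ∀ a ∈ Set.Ioi (0:ℝ), ∫⁻ b in Set.Ioi (0:ℝ), ENNReal.ofReal (w a * g (a + b)) =
        ∫⁻ s in Set.Ioi (0:ℝ), (Set.Iio s).indicator (fun a => ENNReal.ofReal (w a)) a *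
          ENNReal.ofReal (g s) := by
      intro a ha
      rw [← lintegral_indicator measurableSet_Ioi, ← lintegral_indicator measurableSet_Ioi,
        ← lintegral_add_left_eq_self ((Set.Ioi (0:ℝ)).indicator fun s =>
          (Set.Iio s).indicator (fun a => ENNReal.ofReal (w a)) a * ENNReal.ofReal (g s)) a]
      refine lintegral_congr fun b => ?_
      have ha' : 0 < a := ha
      by_cases hb : 0 < b
      · have h1 : 0 < a + b := by positivity
        simp [Set.indicator, hb, h1, hlin a _ ha']
      · simp [Set.indicator, hb]
    rw [setLIntegral_congr_fun measurableSet_Ioi inner, lintegral_lintegral_swap]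
    · refine setLIntegral_congr_fun measurableSet_Ioi fun s hs => ?_
      have hmi : Measurable fun a : ℝ => (Set.Iio s).indicator (fun a => ENNReal.ofReal (w a)) a :=
        (by fun_prop : Measurable fun a => ENNReal.ofReal (w a)).indicator measurableSet_Iio
      rw [lintegral_mul_const _ hmi, ENNReal.ofReal_mul (hW0 s hs), ← hwW s hs,
        lintegral_indicator measurableSet_Iio, Measure.restrict_restrict measurableSet_Iio,
        Set.inter_comm, Set.Ioi_inter_Iio]
    · refine Measurable.aemeasurable ?_
      have : Measurable ({p : ℝ × ℝ | p.1 < p.2}.indicator fun p => ENNReal.ofReal (w p.1)) :=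
        (by fun_prop : Measurable fun p : ℝ × ℝ => ENNReal.ofReal (w p.1)).indicator
          (measurableSet_lt measurable_fst measurable_snd)
      exact this.mul (by fun_prop)
  · filter_upwards [ae_restrict_mem measurableSet_Ioi] with s hs
    exact mul_nonneg (hW0 s hs) (hg0 s hs)
  · exact (hW.mul hg).aestronglyMeasurable
  · filter_upwards [ae_restrict_mem hS] with t ht
    exact mul_nonneg (hw0 _ ht.1) (hg0 _ (add_pos ht.1 ht.2))
  · exact hm.aestronglyMeasurable

theorem lintegral_Ioo_one (s : ℝ) : ∫⁻ _ in Set.Ioo 0 s, ENNReal.ofReal 1 = ENNReal.ofReal s := by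
  simp

theorem lintegral_Ioo_id {s : ℝ} (hs : 0 < s) :
    ∫⁻ t in Set.Ioo 0 s, ENNReal.ofReal t = ENNReal.ofReal (s ^ 2 / 2) := by
  rw [← ofReal_integral_eq_lintegral_ofReal]
  · rw [← integral_Ioc_eq_integral_Ioo, ← intervalIntegral.integral_of_le hs.le, integral_id]
    simp
  · exact (continuous_id.integrableOn_Icc (a := 0) (b := s)).mono_set Set.Ioo_subset_Icc_self
  · filter_upwards [ae_restrict_mem measurableSet_Ioo] with t ht using ht.1.le

theorem integrableOn_pow_mul_exp_neg (k : ℕ) :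
    IntegrableOn (fun s : ℝ => s ^ k * exp (-s)) (Set.Ioi 0) := by
  have := Real.GammaIntegral_convergent (s := k + 1) (by positivity)
  refine this.congr_fun (fun s _ => ?_) measurableSet_Ioi
  simp [mul_comm]

theorem integrable_one_add_abs_pow_mul_exp_neg_abs (k : ℕ) :
    Integrable fun u : ℝ => (1 + |u|) ^ k * exp (-|u|) := by
  have h : IntegrableOn (fun u : ℝ => (1 + u) ^ k * exp (-u)) (Set.Ioi 0) := by
    have : (fun u : ℝ => (1 + u) ^ k * exp (-u)) = fun u => ∑ m ∈ Finset.range (k + 1),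
        (k.choose m : ℝ) * (u ^ m * exp (-u)) := by
      funext u
      rw [add_comm, add_pow, Finset.sum_mul]
      exact Finset.sum_congr rfl fun m _ => by ring
    rw [this]
    exact integrable_finsetSum _ fun m _ => (integrableOn_pow_mul_exp_neg m).const_mul _
  have hi := h.integrable_indicator measurableSet_Ioi
  refine (hi.add hi.comp_neg).congr ?_
  filter_upwards [compl_mem_ae_iff.mpr (measure_singleton (0:ℝ))] with u hu
  rcases lt_or_gt_of_ne (show u ≠ 0 from hu) with h0 | h0
  · simp [Set.indicator, h0, h0.not_gt, abs_of_neg h0]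
  · simp [Set.indicator, h0, h0.not_gt, abs_of_pos h0]

/-- The Fermi-type weight common to the integrands of `Aint` and `Bint`. -/
noncomputable def fermi (l s : ℝ) : ℝ := l * exp (-s) / (1 + (l - 1) * exp (-s))

theorem measurable_fermi (l : ℝ) : Measurable (fermi l) := by
  unfold fermi; fun_prop

theorem one_le_fermi_denom {l : ℝ} (hl : 1 ≤ l) (s : ℝ) : 1 ≤ 1 + (l - 1) * exp (-s) := by
  have := mul_nonneg (sub_nonneg.2 hl) (exp_pos (-s)).le
  linarith

theorem fermi_nonneg {l : ℝ} (hl : 1 ≤ l) (s : ℝ) : 0 ≤ fermi l s := by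
  have := one_le_fermi_denom hl s
  unfold fermi; positivity

theorem fermi_le {l : ℝ} (hl : 1 ≤ l) (s : ℝ) : fermi l s ≤ l * exp (-s) :=
  div_le_self (by positivity) (one_le_fermi_denom hl s)

theorem fermi_le_one {l s : ℝ} (hl : 1 ≤ l) (hs : 0 ≤ s) : fermi l s ≤ 1 := by
  have h1 := one_le_fermi_denom hl s
  have h2 : exp (-s) ≤ 1 := exp_le_one_iff.2 (by linarith)
  rw [fermi, div_le_one (by linarith)]
  linarith

theorem one_sub_fermi_le {l s : ℝ} (hl : 1 ≤ l) (hs : 0 ≤ s) : 1 - fermi l s ≤ exp s / l := by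
  have h1 := one_le_fermi_denom hl s
  have h2 : exp (-s) ≤ 1 := exp_le_one_iff.2 (by linarith)
  have h3 : exp s = 1 / exp (-s) := by rw [exp_neg]; simp
  have h4 := exp_pos (-s)
  rw [h3, div_div, fermi, one_sub_div (by linarith), div_le_div_iff₀ (by linarith) (by positivity)]
  nlinarith [mul_nonneg (by linarith : 0 ≤ l) (sq_nonneg (exp (-s)))]

theorem abs_fermi_sub_indicator_le {l u : ℝ} (hl : 1 ≤ l) (hu : 0 < log l + u) :
    |fermi l (log l + u) - (Set.Iio 0).indicator 1 u| ≤ exp (-|u|) := by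
  have hl0 : 0 < l := by linarith
  rcases lt_or_ge u 0 with h | h
  · have h1 := fermi_le_one hl hu.le
    have h2 := one_sub_fermi_le hl hu.le
    rw [exp_add, exp_log hl0, mul_div_cancel_left₀ _ hl0.ne'] at h2
    rw [Set.indicator_of_mem (Set.mem_Iio.2 h), abs_of_neg h, neg_neg, Pi.one_apply, abs_sub_comm,
      abs_of_nonneg (by linarith)]
    exact h2
  · have h2 := fermi_le hl (log l + u)
    rw [neg_add, exp_add, exp_neg (log l), exp_log hl0, mul_inv_cancel_left₀ hl0.ne'] at h2
    rw [Set.indicator_of_notMem (by simpa using h), sub_zero, abs_of_nonneg (fermi_nonneg hl _),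
      abs_of_nonneg h]
    exact h2

theorem tendsto_fermi_log_add (u : ℝ) :
    Tendsto (fun l => fermi l (log l + u)) atTop (nhds (exp (-u) / (1 + exp (-u)))) := by
  have h : Tendsto (fun l : ℝ => exp (-u) / (1 + (1 - l⁻¹) * exp (-u))) atTop
      (nhds (exp (-u) / (1 + (1 - 0) * exp (-u)))) := by
    refine Tendsto.div tendsto_const_nhds ?_ (by positivity)
    exact ((tendsto_inv_atTop_zero.const_sub 1).mul_const _).const_add 1
  rw [sub_zero, one_mul] at h
  refine h.congr' ?_
  filter_upwards [eventually_gt_atTop 0] with l hl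
  rw [fermi, neg_add, exp_add, exp_neg (log l), exp_log hl]
  congr 1
  · field_simp
  · field_simp

/-- The limiting profile minus the step function is odd. -/
theorem integral_fermi_profile_sub_indicator :
    ∫ u : ℝ, (exp (-u) / (1 + exp (-u)) - (Set.Iio 0).indicator 1 u) = 0 := by
  set F : ℝ → ℝ := fun u => exp (-u) / (1 + exp (-u)) - (Set.Iio 0).indicator 1 u with hF
  have h1 := integral_neg_eq_self F volume
  have h2 : ∫ u, F (-u) = ∫ u, -F u := by
    refine integral_congr_ae ?_
    filter_upwards [compl_mem_ae_iff.mpr (measure_singleton (0:ℝ))] with u hu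
    have hx : exp (-(-u)) = 1 / exp (-u) := by rw [exp_neg (-u)]; simp
    have hp := exp_pos (-u)
    have hh : exp (-(-u)) / (1 + exp (-(-u))) = 1 - exp (-u) / (1 + exp (-u)) := by
      rw [hx]; field_simp; ring
    simp only [hF, hh]
    rcases lt_or_gt_of_ne (show u ≠ 0 from hu) with h0 | h0
    · simp [Set.indicator, h0, h0.not_gt]
    · simp [Set.indicator, h0, h0.not_gt]
  rw [integral_neg] at h2
  linarith

theorem integrableOn_pow_mul_fermi {l : ℝ} (hl : 1 ≤ l) (k : ℕ) :
    IntegrableOn (fun s => s ^ k * fermi l s) (Set.Ioi 0) := by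
  refine ((integrableOn_pow_mul_exp_neg k).const_mul l).mono'
    ((measurable_id.pow_const k).mul (measurable_fermi l)).aestronglyMeasurable ?_
  filter_upwards [ae_restrict_mem measurableSet_Ioi] with s hs
  have hs : 0 < s := hs
  rw [norm_of_nonneg (mul_nonneg (by positivity) (fermi_nonneg hl s))]
  calc s ^ k * fermi l s ≤ s ^ k * (l * exp (-s)) := by gcongr; exact fermi_le hl s
    _ = _ := by ring

theorem tendsto_integral_pow_mul_fermi (k : ℕ) :
    Tendsto (fun l => (∫ s in Set.Ioi (0:ℝ), s ^ k * fermi l s) / log l ^ k - log l / (k + 1))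
      atTop (nhds 0) := by
  let D : ℝ → ℝ → ℝ := fun l u => (Set.Ioi 0).indicator (fun _ =>
    ((log l + u) / log l) ^ k * (fermi l (log l + u) - (Set.Iio 0).indicator 1 u)) (log l + u)
  have hD : Tendsto (fun l => ∫ u, D l u) atTop
      (nhds (∫ u : ℝ, (exp (-u) / (1 + exp (-u)) - (Set.Iio 0).indicator 1 u))) := by
    refine tendsto_integral_filter_of_dominated_convergence _ ?_ ?_
      (integrable_one_add_abs_pow_mul_exp_neg_abs k) ?_
    · refine Eventually.of_forall fun l => ?_
      have h1 : Measurable fun u => fermi l (log l + u) :=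
        (measurable_fermi l).comp (measurable_const_add _)
      have h2 : Measurable ((Set.Iio (0:ℝ)).indicator (1 : ℝ → ℝ)) :=
        measurable_one.indicator measurableSet_Iio
      have h3 : Measurable ({u : ℝ | 0 < log l + u}.indicator fun u : ℝ =>
          ((log l + u) / log l) ^ k * (fermi l (log l + u) - (Set.Iio 0).indicator 1 u)) := by
        refine Measurable.indicator ?_ (measurableSet_lt measurable_const (by fun_prop))
        exact Measurable.mul (by fun_prop) (h1.sub h2)
      exact h3.aestronglyMeasurable
    · filter_upwards [eventually_ge_atTop 1, tendsto_log_atTop.eventually_ge_atTop 1] with l hl hL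
      refine Eventually.of_forall fun u => ?_
      by_cases hu : 0 < log l + u
      · simp only [D, Set.indicator_of_mem (Set.mem_Ioi.2 hu), norm_mul, norm_pow, norm_eq_abs]
        gcongr ?_ ^ k * ?_
        · rw [abs_of_nonneg (by positivity), div_le_iff₀ (by linarith)]
          nlinarith [le_abs_self u, abs_nonneg u]
        · exact abs_fermi_sub_indicator_le hl hu
      · simp only [D, Set.indicator_of_notMem (show log l + u ∉ Set.Ioi 0 from hu), norm_zero]
        positivity
    · refine Eventually.of_forall fun u => ?_
      have h1 : Tendsto (fun l => ((log l + u) / log l) ^ k) atTop (nhds 1) := by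
        have : Tendsto (fun l => (1 + u * (log l)⁻¹) ^ k) atTop (nhds ((1 + u * 0) ^ k)) :=
          (((tendsto_inv_atTop_zero.comp tendsto_log_atTop).const_mul u).const_add 1).pow k
        rw [mul_zero, add_zero, one_pow] at this
        refine this.congr' ?_
        filter_upwards [tendsto_log_atTop.eventually_gt_atTop 0] with l hL
        congr 1
        field_simp
      have h2 := h1.mul ((tendsto_fermi_log_add u).sub_const ((Set.Iio 0).indicator 1 u))
      rw [one_mul] at h2
      refine h2.congr' ?_
      filter_upwards [tendsto_log_atTop.eventually_gt_atTop (-u)] with l hL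
      simp only [D]
      rw [Set.indicator_of_mem (Set.mem_Ioi.2 (by linarith))]
  rw [integral_fermi_profile_sub_indicator] at hD
  refine hD.congr' ?_
  filter_upwards [eventually_ge_atTop 1, tendsto_log_atTop.eventually_gt_atTop 0] with l hl hL
  have hpow : IntegrableOn (fun s : ℝ => (Set.Iio (log l)).indicator (fun s => s ^ k) s)
      (Set.Ioi 0) := by
    rw [IntegrableOn, integrable_indicator_iff measurableSet_Iio, IntegrableOn,
      Measure.restrict_restrict measurableSet_Iio, Set.inter_comm, Set.Ioi_inter_Iio]
    exact ((continuous_pow k).integrableOn_Icc (a := 0) (b := log l)).mono_set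
      Set.Ioo_subset_Icc_self
  have hval : ∫ s in Set.Ioi (0:ℝ), (Set.Iio (log l)).indicator (fun s => s ^ k) s =
      log l ^ (k + 1) / (k + 1) := by
    rw [integral_indicator measurableSet_Iio, Measure.restrict_restrict measurableSet_Iio,
      Set.inter_comm, Set.Ioi_inter_Iio, ← integral_Ioc_eq_integral_Ioo,
      ← intervalIntegral.integral_of_le hL.le, integral_pow]
    simp
  have hshift := integral_add_left_eq_self (μ := volume) (fun s => (Set.Ioi (0:ℝ)).indicator
    (fun s => (s ^ k * fermi l s - (Set.Iio (log l)).indicator (fun s => s ^ k) s) / log l ^ k) s)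
    (log l)
  rw [integral_indicator measurableSet_Ioi, integral_div,
    integral_sub (integrableOn_pow_mul_fermi hl k) hpow, hval] at hshift
  have hD' : ∫ u, D l u = ∫ u, (Set.Ioi (0:ℝ)).indicator
    (fun s => (s ^ k * fermi l s - (Set.Iio (log l)).indicator (fun s => s ^ k) s) / log l ^ k)
      (log l + u) := by
    refine integral_congr_ae (Eventually.of_forall fun u => ?_)
    by_cases hu : 0 < log l + u
    · by_cases h : u < 0
      · simp [D, Set.indicator, hu, h, div_pow]; ring
      · simp [D, Set.indicator, hu, h, div_pow]; ring
    · simp [D, Set.indicator, hu]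
  rw [hD', hshift, sub_div]
  congr 1
  rw [div_right_comm, pow_succ, mul_div_cancel_left₀ _ (pow_pos hL k).ne']

theorem Bint_eq_integral_fermi {l : ℝ} (hl : 1 ≤ l) :
    Bint l = ∫ s in Set.Ioi (0:ℝ), s ^ 1 * fermi l s := by
  have h := setIntegral_quadrant_mul_comp_add (w := fun _ => 1) (W := fun s => s)
    measurable_const (measurable_fermi l) (fun _ _ => zero_le_one) (fun s _ => fermi_nonneg hl s)
    measurable_id (fun s hs => hs.le) (fun s _ => lintegral_Ioo_one s)
  simp only [one_mul] at h
  simpa [Bint, fermi] using h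

/-- `Aint` differs from half the second moment of the Fermi weight by a bounded amount. -/
theorem abs_Aint_sub_integral_fermi_le {l : ℝ} (hl : 1 ≤ l) :
    |Aint l - (∫ s in Set.Ioi (0:ℝ), s ^ 2 * fermi l s) / 2| ≤
      ∫ s in Set.Ioi (0:ℝ), (s ^ 1 * exp (-s) + s ^ 2 * exp (-s)) := by
  have hx : ∀ s : ℝ, 0 < s → 0 < 1 - exp (-s) := fun s hs => by
    have : exp (-s) < 1 := exp_lt_one_iff.2 (by linarith)
    linarith
  have hA : Aint l = ∫ s in Set.Ioi (0:ℝ), s ^ 2 / 2 * (fermi l s / (1 - exp (-s))) := by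
    rw [← setIntegral_quadrant_mul_comp_add (w := fun t => t)
      (W := fun s => s ^ 2 / 2) (g := fun s => fermi l s / (1 - exp (-s))) measurable_id
      ((measurable_fermi l).div (by fun_prop)) (fun t ht => ht.le)
      (fun s hs => div_nonneg (fermi_nonneg hl s) (hx s hs).le) (by fun_prop)
      (fun s _ => by positivity) (fun s hs => lintegral_Ioo_id hs)]
    unfold Aint fermi
    congr 1 with t
    rw [div_div, mul_div_assoc', mul_comm (1 + _)]
    congr 1
    ring
  have hI := (integrableOn_pow_mul_exp_neg 1).add (integrableOn_pow_mul_exp_neg 2)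
  have hbound : ∀ s ∈ Set.Ioi (0:ℝ), ‖s ^ 2 / 2 * (fermi l s * exp (-s) / (1 - exp (-s)))‖ ≤
      s ^ 1 * exp (-s) + s ^ 2 * exp (-s) := by
    intro s hs
    have hs : 0 < s := hs
    have h1 := hx s hs
    have h0 := fermi_nonneg hl s
    have h2 : s / (1 - exp (-s)) ≤ 1 + s := by
      rw [div_le_iff₀ h1]
      have h3 : (1 + s) * exp (-s) ≤ 1 := by
        calc (1 + s) * exp (-s) ≤ exp s * exp (-s) := by
              gcongr; linarith [add_one_le_exp s]
          _ = 1 := by rw [← exp_add]; simp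
      linarith
    rw [norm_of_nonneg (by positivity)]
    calc s ^ 2 / 2 * (fermi l s * exp (-s) / (1 - exp (-s)))
        = s * exp (-s) * (s / (1 - exp (-s))) * (fermi l s / 2) := by ring
      _ ≤ s * exp (-s) * (1 + s) * 1 := by
          gcongr
          linarith [fermi_le_one hl hs.le]
      _ = _ := by ring
  have hR : IntegrableOn (fun s => s ^ 2 / 2 * (fermi l s * exp (-s) / (1 - exp (-s))))
      (Set.Ioi 0) := by
    refine Integrable.mono' hI ?_ ((ae_restrict_mem measurableSet_Ioi).mono hbound)
    refine Measurable.aestronglyMeasurable ?_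
    have := measurable_fermi l
    fun_prop
  have hsplit : Aint l = (∫ s in Set.Ioi (0:ℝ), s ^ 2 * fermi l s) / 2 +
      ∫ s in Set.Ioi (0:ℝ), s ^ 2 / 2 * (fermi l s * exp (-s) / (1 - exp (-s))) := by
    rw [hA, ← integral_div, ← integral_add ((integrableOn_pow_mul_fermi hl 2).div_const 2) hR]
    refine setIntegral_congr_fun measurableSet_Ioi fun s hs => ?_
    have := (hx s hs).ne'
    field_simp
    ring
  rw [hsplit, add_sub_cancel_left]
  exact norm_integral_le_of_norm_le hI ((ae_restrict_mem measurableSet_Ioi).mono hbound)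

theorem tendsto_Bint_div_log_sub :
    Tendsto (fun l => Bint l / log l - log l / 2) atTop (nhds 0) := by
  refine (tendsto_integral_pow_mul_fermi 1).congr' ?_
  filter_upwards [eventually_ge_atTop 1] with l hl
  rw [Bint_eq_integral_fermi hl]
  norm_num

theorem tendsto_Aint_div_log_sq_sub :
    Tendsto (fun l => Aint l / log l ^ 2 - log l / 6) atTop (nhds 0) := by
  have h1 := (tendsto_integral_pow_mul_fermi 2).div_const 2
  have hinv : Tendsto (fun l => (log l)⁻¹) atTop (nhds 0) :=
    tendsto_inv_atTop_zero.comp tendsto_log_atTop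
  have h2 : Tendsto (fun l => (Aint l - (∫ s in Set.Ioi (0:ℝ), s ^ 2 * fermi l s) / 2) *
      (log l)⁻¹ ^ 2) atTop (nhds 0) := by
    have h3 := (hinv.pow 2).const_mul
      (∫ s in Set.Ioi (0:ℝ), (s ^ 1 * exp (-s) + s ^ 2 * exp (-s)))
    rw [zero_pow two_ne_zero, mul_zero] at h3
    refine squeeze_zero_norm' ?_ h3
    filter_upwards [eventually_ge_atTop 1] with l hl
    rw [norm_mul, norm_pow, norm_eq_abs, norm_eq_abs, sq_abs]
    gcongr
    exact abs_Aint_sub_integral_fermi_le hl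
  have h4 := h1.add h2
  rw [zero_div, add_zero] at h4
  refine h4.congr fun l => ?_
  push_cast
  ring

/-- As `λ → +∞`, `c(λ) → 3·π^{−2/3}` and `e(λ) → 0`. -/
theorem statement6 :
    Tendsto cfun atTop (nhds (3 / π ^ ((2:ℝ)/3))) ∧
    Tendsto efun atTop (nhds 0) := by
  have hz : 0 < zeta2 := by unfold zeta2; positivity
  have hinv : Tendsto (fun l => (log l)⁻¹) atTop (nhds 0) :=
    tendsto_inv_atTop_zero.comp tendsto_log_atTop
  have hL := tendsto_log_atTop.eventually_gt_atTop 0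
  have hA : Tendsto (fun l => Aint l / log l ^ 3) atTop (nhds (1 / 6)) := by
    have := (tendsto_Aint_div_log_sq_sub.mul hinv).add_const (1 / 6 : ℝ)
    rw [zero_mul, zero_add] at this
    refine this.congr' ?_
    filter_upwards [hL] with l hl
    field_simp
    ring
  have hB : Tendsto (fun l => Bint l / log l ^ 2) atTop (nhds (1 / 2)) := by
    have := (tendsto_Bint_div_log_sub.mul hinv).add_const (1 / 2 : ℝ)
    rw [zero_mul, zero_add] at this
    refine this.congr' ?_
    filter_upwards [hL] with l hl
    field_simp
    ring
  have hApos : ∀ᶠ l in atTop, 0 < Aint l := by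
    filter_upwards [hL, hA.eventually_const_lt (by norm_num : (0:ℝ) < 1 / 6)] with l hl h
    exact (div_pos_iff_of_pos_right (by positivity)).1 h
  have hden : Tendsto (fun l => zeta2 ^ ((1:ℝ)/3) * (Aint l / log l ^ 3) ^ ((2:ℝ)/3)) atTop
      (nhds (zeta2 ^ ((1:ℝ)/3) * (1 / 6) ^ ((2:ℝ)/3))) :=
    (hA.rpow_const (Or.inl (by norm_num))).const_mul _
  have hden0 : zeta2 ^ ((1:ℝ)/3) * (1 / 6) ^ ((2:ℝ)/3) ≠ 0 := by positivity
  have hscale : ∀ l, 0 < log l → 0 < Aint l →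
      (Aint l / log l ^ 3) ^ ((2:ℝ)/3) = Aint l ^ ((2:ℝ)/3) / log l ^ 2 := by
    intro l hl ha
    rw [div_rpow ha.le (by positivity), ← rpow_natCast (log l) 3, ← rpow_mul hl.le,
      ← rpow_natCast (log l) 2]
    norm_num
  constructor
  · have hlim : (1 / 2) / (zeta2 ^ ((1:ℝ)/3) * (1 / 6) ^ ((2:ℝ)/3)) = 3 / π ^ ((2:ℝ)/3) := by
      have h1 : zeta2 ^ ((1:ℝ)/3) = π ^ ((2:ℝ)/3) * (1 / 6) ^ ((1:ℝ)/3) := by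
        rw [zeta2, div_eq_mul_one_div, mul_rpow (by positivity) (by positivity),
          ← rpow_natCast π 2, ← rpow_mul pi_pos.le]
        norm_num
      have h2 : ((1:ℝ) / 6) ^ ((1:ℝ)/3) * (1 / 6) ^ ((2:ℝ)/3) = 1 / 6 := by
        rw [← rpow_add (by norm_num)]
        norm_num
      rw [h1, mul_assoc, h2]
      field_simp
      norm_num
    rw [← hlim]
    refine (hB.div hden hden0).congr' ?_
    filter_upwards [hL, hApos] with l hl ha
    rw [Pi.div_apply, hscale l hl ha, cfun]
    field_simp
  · have hnum := (tendsto_Aint_div_log_sq_sub.const_mul 3).sub tendsto_Bint_div_log_sub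
    have h := hnum.div hden hden0
    rw [mul_zero, sub_zero, zero_div] at h
    refine h.congr' ?_
    filter_upwards [hL, hApos] with l hl ha
    have hA3 : (Aint l / zeta2) ^ ((1:ℝ)/3) =
        Aint l / (zeta2 ^ ((1:ℝ)/3) * Aint l ^ ((2:ℝ)/3)) := by
      have h3 : Aint l ^ ((1:ℝ)/3) * Aint l ^ ((2:ℝ)/3) = Aint l := by
        rw [← rpow_add ha]
        norm_num
      rw [div_rpow ha.le hz.le, div_eq_div_iff (by positivity) (by positivity)]
      linear_combination zeta2 ^ ((1:ℝ)/3) * h3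
    rw [Pi.div_apply, hscale l hl ha, efun, cfun, hA3]
    have hp : 0 < Aint l ^ ((2:ℝ)/3) := by positivity
    have hq : 0 < zeta2 ^ ((1:ℝ)/3) := by positivity
    generalize Aint l ^ ((2:ℝ)/3) = p at *
    generalize zeta2 ^ ((1:ℝ)/3) = q at *
    field_simp
    ring
end
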